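/- arXiv:1012.0014 — 2 statements merged into one kernel-verified Lean document; each statement's English description precedes it below -/
import Mathlib

section
/- For variables x₁,…,x_e and y₁,…,y_f, one has ∏_{1≤i≤e, 1≤j≤f} (x_i + y_j) = ∑_{λ ⊆ e×f} s_λ(x₁,…,x_e) · s_{e×f−λ̃}(y₁,…,y_f), where e×f−λ̃ = (e − λ*_f, …, e − λ*_1) is the complement of λ in the e×f rectangle. -/
open scoped Classical BigOperators
noncomputable section

namespace ChernTensor

/-- The rectangular Young diagram with `r` rows each of length `c`. -/
def rect (r c : ℕ) : YoungDiagram :=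
  ⟨Finset.range r ×ˢ Finset.range c, by
    intro p q hle hp
    simp only [Finset.coe_product, Set.mem_prod, Finset.mem_coe, Finset.mem_range] at hp ⊢
    exact ⟨lt_of_le_of_lt hle.1 hp.1, lt_of_le_of_lt hle.2 hp.2⟩⟩

/-- The complement of a diagram `d` (rotated by 180°) inside the rectangle
with `r` rows and `c` columns. -/
def complIn (r c : ℕ) (d : YoungDiagram) : YoungDiagram :=
  ⟨(Finset.range r ×ˢ Finset.range c).filter
      (fun p => (r - 1 - p.1, c - 1 - p.2) ∉ d), by
    intro p q hle hp
    simp only [Finset.coe_filter, Set.mem_setOf_eq, Finset.mem_product,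
      Finset.mem_range] at hp ⊢
    refine ⟨⟨lt_of_le_of_lt hle.1 hp.1.1, lt_of_le_of_lt hle.2 hp.1.2⟩, fun hq => hp.2 ?_⟩
    exact d.isLowerSet (Prod.mk_le_mk.mpr ⟨Nat.sub_le_sub_left hle.1 _,
      Nat.sub_le_sub_left hle.2 _⟩) hq⟩

/-- The complement `e×f − ν̃ = (e − ν*_f, …, e − ν*_1)` of `ν` in the rectangle
with `f` rows each of length `e` (the paper's `e×f`). -/
def rectCompl (e f : ℕ) (ν : YoungDiagram) : YoungDiagram :=
  complIn f e ν.transpose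

/-- The product of the hook lengths of all boxes of a Young diagram, as a rational. -/
def hookProd (ν : YoungDiagram) : ℚ :=
  ∏ c ∈ ν.cells, ((ν.rowLen c.1 + ν.colLen c.2 - c.1 - c.2 - 1 : ℕ) : ℚ)

/-- The content polynomial `(n | ρ) = ∏_{(i,j) ∈ ρ} (n + j − i)` evaluated at `n`. -/
def contPoly (n : ℚ) (ρ : YoungDiagram) : ℚ :=
  ∏ c ∈ ρ.cells, (n + (c.2 : ℚ) - (c.1 : ℚ))

/-- The skew content polynomial `(n | ρ − σ) = ∏_{(i,j) ∈ ρ/σ} (n + j − i)`. -/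
def skewContPoly (n : ℚ) (ρ σ : YoungDiagram) : ℚ :=
  ∏ c ∈ ρ.cells \ σ.cells, (n + (c.2 : ℚ) - (c.1 : ℚ))

/-- `T : ℕ×ℕ → ℕ` is a Littlewood–Richardson skew tableau of shape `ν/λ` and
content `μ`: entries (≥ 1) exactly on the skew cells, rows weakly increasing,
columns strictly increasing, exactly `μ_k` entries equal to `k` (1-indexed),
and the reverse reading word is a lattice word. -/
def IsLRTableau (lam mu nu : YoungDiagram) (T : ℕ × ℕ → ℕ) : Prop :=
  (∀ c : ℕ × ℕ, c ∈ nu.cells \ lam.cells ↔ T c ≠ 0) ∧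
  (∀ i j j', j ≤ j' → (i, j) ∈ nu.cells \ lam.cells → (i, j') ∈ nu.cells \ lam.cells →
    T (i, j) ≤ T (i, j')) ∧
  (∀ i i' j, i < i' → (i, j) ∈ nu.cells \ lam.cells → (i', j) ∈ nu.cells \ lam.cells →
    T (i, j) < T (i', j)) ∧
  (∀ k : ℕ, ((nu.cells \ lam.cells).filter (fun c => T c = k + 1)).card = mu.rowLen k) ∧
  (∀ c ∈ nu.cells \ lam.cells, ∀ k : ℕ,
    (((nu.cells \ lam.cells).filter
        (fun d => (d.1 < c.1 ∨ (d.1 = c.1 ∧ c.2 ≤ d.2)) ∧ T d = k + 2)).card ≤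
     ((nu.cells \ lam.cells).filter
        (fun d => (d.1 < c.1 ∨ (d.1 = c.1 ∧ c.2 ≤ d.2)) ∧ T d = k + 1)).card))

/-- The Littlewood–Richardson coefficient `c^ν_{λμ}`, defined as the number of
Littlewood–Richardson skew tableaux of shape `ν/λ` and content `μ`. -/
def lrCoeff (lam mu nu : YoungDiagram) : ℕ :=
  if lam ≤ nu then Nat.card {T : ℕ × ℕ → ℕ // IsLRTableau lam mu nu T} else 0

/-- The universal coefficient `P_{λ,μ}(e,f) = ∑_ν c^{ν*}_{λ*,μ} (e|ν−λ)(f|ν*−μ)/h(ν)`. -/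
def P (lam mu : YoungDiagram) (e f : ℚ) : ℚ :=
  ∑ᶠ nu : YoungDiagram, (lrCoeff lam.transpose mu nu.transpose : ℚ) *
    skewContPoly e nu lam * skewContPoly f nu.transpose mu / hookProd nu

/-- A semistandard filling of the cells of `lam` with values in `Fin n`:
weakly increasing along rows, strictly increasing down columns. -/
def IsSSYT (lam : YoungDiagram) {n : ℕ} (T : lam.cells → Fin n) : Prop :=
  (∀ a b : lam.cells, (a : ℕ × ℕ).1 = (b : ℕ × ℕ).1 → (a : ℕ × ℕ).2 ≤ (b : ℕ × ℕ).2 →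
    T a ≤ T b) ∧
  (∀ a b : lam.cells, (a : ℕ × ℕ).2 = (b : ℕ × ℕ).2 → (a : ℕ × ℕ).1 < (b : ℕ × ℕ).1 →
    T a < T b)

/-- The Schur polynomial `s_λ(x₁,…,x_n)` evaluated at `x`, as the generating
function of semistandard tableaux. -/
def schur (lam : YoungDiagram) {n : ℕ} (x : Fin n → ℚ) : ℚ :=
  ∑ᶠ T : {T : lam.cells → Fin n // IsSSYT lam T}, ∏ c : lam.cells, x (T.1 c)

/-- The generalized binomial coefficient `C(a, b) = a(a−1)⋯(a−b+1)/b!`. -/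
def gbinom (a : ℚ) (b : ℕ) : ℚ :=
  (∏ i ∈ Finset.range b, (a - i)) / (Nat.factorial b : ℚ)


/-- The skew shape `μ/κ` has no two boxes in the same column. -/
def IsHorizontalStrip (κ μ : YoungDiagram) : Prop :=
  κ ≤ μ ∧ ∀ i j, (i + 1, j) ∈ μ → (i, j) ∈ κ

lemma finite_setOf_le (μ : YoungDiagram) : {κ : YoungDiagram | κ ≤ μ}.Finite := by
  refine Set.Finite.of_finite_image (f := YoungDiagram.cells)
    ((μ.cells.powerset : Set (Finset (ℕ × ℕ))).toFinite.subset ?_) ?_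
  · rintro _ ⟨κ, hκ, rfl⟩
    simpa using hκ
  · intro a _ b _ h
    exact YoungDiagram.ext h

/-- The diagrams with at most `n` rows obtained from `μ` by removing a horizontal strip. -/
def stripRemovals (n : ℕ) (μ : YoungDiagram) : Finset YoungDiagram :=
  (finite_setOf_le μ).toFinset.filter fun κ => IsHorizontalStrip κ μ ∧ (n, 0) ∉ κ

lemma mem_stripRemovals {n : ℕ} {κ μ : YoungDiagram} :
    κ ∈ stripRemovals n μ ↔ IsHorizontalStrip κ μ ∧ (n, 0) ∉ κ := by
  simp only [stripRemovals, Finset.mem_filter, Set.Finite.mem_toFinset, Set.mem_ofPred_eq,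
    and_iff_right_iff_imp]
  exact fun h => h.1.1

lemma schur_eq_sum (μ : YoungDiagram) {n : ℕ} (x : Fin n → ℚ) :
    schur μ x = ∑ T : μ.cells → Fin n with IsSSYT μ T, ∏ c, x (T c) := by
  rw [schur, finsum_eq_sum_of_fintype]
  exact (Finset.sum_subtype _ (by simp) fun T : μ.cells → Fin n => ∏ c, x (T c)).symm

lemma schur_bot {n : ℕ} (x : Fin n → ℚ) : schur ⊥ x = 1 := by
  have : IsEmpty (⊥ : YoungDiagram).cells :=
    Subtype.isEmpty_of_false fun c => YoungDiagram.notMem_bot c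
  rw [schur_eq_sum, Finset.filter_true_of_mem]
  · simp
  · exact fun T _ => ⟨fun a => isEmptyElim a, fun a => isEmptyElim a⟩

lemma IsSSYT.le_of_mem {μ : YoungDiagram} {n : ℕ} {T : μ.cells → Fin n} (hT : IsSSYT μ T)
    (i : ℕ) (h : (i, 0) ∈ μ.cells) : i ≤ T ⟨(i, 0), h⟩ := by
  induction i with
  | zero => exact Nat.zero_le _
  | succ i ih =>
    have h' : (i, 0) ∈ μ.cells := μ.up_left_mem (Nat.le_succ i) le_rfl h
    have : T ⟨(i, 0), h'⟩ < T ⟨(i + 1, 0), h⟩ := hT.2 _ _ rfl (Nat.lt_succ_self i)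
    exact Nat.succ_le_of_lt ((ih h').trans_lt this)

/-- The boxes of a tableau not filled with the largest possible entry. -/
def truncation {μ : YoungDiagram} {n : ℕ} (T : μ.cells → Fin (n + 1)) (hT : IsSSYT μ T) :
    YoungDiagram where
  cells := (Finset.univ.filter fun c => T c ≠ Fin.last n).map (Function.Embedding.subtype _)
  isLowerSet := by
    intro p q hle hp
    simp only [Finset.coe_map, Set.mem_image, Finset.coe_filter, Finset.mem_univ, true_and,
      Set.mem_ofPred_eq, Function.Embedding.subtype_apply, Subtype.exists, exists_and_right,
      exists_eq_right] at hp ⊢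
    obtain ⟨hpμ, hp⟩ := hp
    have hq : q ∈ μ.cells := μ.isLowerSet hle hpμ
    refine ⟨hq, ?_⟩
    have hr : (p.1, q.2) ∈ μ.cells := μ.isLowerSet (show (p.1, q.2) ≤ p from ⟨le_rfl, hle.2⟩) hpμ
    have h1 : T ⟨(p.1, q.2), hr⟩ ≤ T ⟨p, hpμ⟩ := hT.1 _ _ rfl hle.2
    have h2 : T ⟨q, hq⟩ ≤ T ⟨(p.1, q.2), hr⟩ := by
      rcases hle.1.lt_or_eq with h | h
      · exact (hT.2 ⟨q, hq⟩ ⟨(p.1, q.2), hr⟩ rfl h).le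
      · exact le_of_eq (congrArg T (Subtype.ext (Prod.ext h rfl)))
    exact ((h2.trans h1).trans_lt (Fin.lt_last_iff_ne_last.2 hp)).ne

lemma mem_truncation {μ : YoungDiagram} {n : ℕ} {T : μ.cells → Fin (n + 1)} {hT : IsSSYT μ T}
    {c : ℕ × ℕ} : c ∈ truncation T hT ↔ ∃ h : c ∈ μ.cells, T ⟨c, h⟩ ≠ Fin.last n := by
  rw [← YoungDiagram.mem_cells]
  simp [truncation]

lemma truncation_mem_stripRemovals {μ : YoungDiagram} {n : ℕ} {T : μ.cells → Fin (n + 1)}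
    (hT : IsSSYT μ T) : truncation T hT ∈ stripRemovals n μ := by
  rw [mem_stripRemovals]
  refine ⟨⟨fun c hc => (mem_truncation.1 hc).1, fun i j h => ?_⟩, fun h => ?_⟩
  · have h' : (i, j) ∈ μ.cells := μ.up_left_mem (Nat.le_succ i) le_rfl h
    refine mem_truncation.2 ⟨h', ?_⟩
    exact ((hT.2 ⟨(i, j), h'⟩ ⟨(i + 1, j), h⟩ rfl (Nat.lt_succ_self i)).trans_le
      (Fin.le_last _)).ne
  · obtain ⟨h, hne⟩ := mem_truncation.1 h
    exact hne (Fin.last_le_iff.1 (Fin.le_def.2 (hT.le_of_mem n h)))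

/-- Extend a filling of `κ` to `μ` by the largest entry. -/
def extendFilling (κ μ : YoungDiagram) {n : ℕ} (T : κ.cells → Fin n) :
    μ.cells → Fin (n + 1) :=
  fun c => if h : (c : ℕ × ℕ) ∈ κ.cells then (T ⟨c, h⟩).castSucc else Fin.last n

lemma IsSSYT.extendFilling {κ μ : YoungDiagram} {n : ℕ} {T : κ.cells → Fin n}
    (hT : IsSSYT κ T) (h : IsHorizontalStrip κ μ) : IsSSYT μ (extendFilling κ μ T) := by
  refine ⟨fun a b h1 h2 => ?_, fun a b h1 h2 => ?_⟩ <;> unfold ChernTensor.extendFilling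
  · by_cases hb : (b : ℕ × ℕ) ∈ κ.cells
    · have ha : (a : ℕ × ℕ) ∈ κ.cells :=
        κ.isLowerSet (show (a : ℕ × ℕ) ≤ b from ⟨h1.le, h2⟩) hb
      rw [dif_pos ha, dif_pos hb]
      exact Fin.castSucc_le_castSucc_iff.2 (hT.1 ⟨a, ha⟩ ⟨b, hb⟩ h1 h2)
    · rw [dif_neg hb]
      exact Fin.le_last _
  · have ha : (a : ℕ × ℕ) ∈ κ.cells := by
      refine h.2 _ _ (μ.isLowerSet (show ((a : ℕ × ℕ).1 + 1, (a : ℕ × ℕ).2) ≤ (b : ℕ × ℕ) from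
        ⟨h2, h1.le⟩) b.2)
    rw [dif_pos ha]
    by_cases hb : (b : ℕ × ℕ) ∈ κ.cells
    · rw [dif_pos hb]
      exact Fin.castSucc_lt_castSucc_iff.2 (hT.2 ⟨a, ha⟩ ⟨b, hb⟩ h1 h2)
    · rw [dif_neg hb]
      exact Fin.castSucc_lt_last _

lemma prod_extendFilling {κ μ : YoungDiagram} {n : ℕ} (T : κ.cells → Fin n) (h : κ ≤ μ)
    (x : Fin (n + 1) → ℚ) :
    ∏ c, x (extendFilling κ μ T c) =
      (∏ c, x (T c).castSucc) * x (Fin.last n) ^ (μ.card - κ.card) := by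
  let g : ℕ × ℕ → ℚ := fun c =>
    x (if h : c ∈ κ.cells then (T ⟨c, h⟩).castSucc else Fin.last n)
  have hsub : κ.cells ⊆ μ.cells := YoungDiagram.cells_subset_iff.2 h
  have h1 : ∏ c, x (extendFilling κ μ T c) = ∏ c ∈ μ.cells, g c :=
    Finset.prod_coe_sort μ.cells g
  have h2 : ∏ c, x (T c).castSucc = ∏ c ∈ κ.cells, g c := by
    rw [← Finset.prod_coe_sort κ.cells g]
    exact Finset.prod_congr rfl fun c _ => by simp only [g, dif_pos c.2]
  have h3 : ∏ c ∈ μ.cells \ κ.cells, g c = x (Fin.last n) ^ (μ.card - κ.card) := by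
    rw [YoungDiagram.card, YoungDiagram.card, ← Finset.card_sdiff_of_subset hsub]
    refine Finset.prod_eq_pow_card fun c hc => ?_
    simp only [g, dif_neg (Finset.mem_sdiff.1 hc).2]
  rw [h1, h2, ← h3, mul_comm, Finset.prod_sdiff hsub]

/-- Branching rule for Schur polynomials. -/
theorem schur_succ (μ : YoungDiagram) {n : ℕ} (x : Fin (n + 1) → ℚ) :
    schur μ x = ∑ κ ∈ stripRemovals n μ,
      schur κ (fun i => x i.castSucc) * x (Fin.last n) ^ (μ.card - κ.card) := by
  rw [schur_eq_sum]
  let t : (μ.cells → Fin (n + 1)) → YoungDiagram :=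
    fun T => if hT : IsSSYT μ T then truncation T hT else ⊥
  have ht : ∀ T, (hT : IsSSYT μ T) → t T = truncation T hT := fun T hT => dif_pos hT
  rw [← Finset.sum_fiberwise_of_maps_to (g := t) (t := stripRemovals n μ)]
  swap
  · intro T hT
    have hT := (Finset.mem_filter.1 hT).2
    rw [ht T hT]
    exact truncation_mem_stripRemovals hT
  refine Finset.sum_congr rfl fun κ hκ => ?_
  obtain ⟨hs, -⟩ := mem_stripRemovals.1 hκ
  rw [schur_eq_sum, Finset.sum_mul]
  symm
  refine Finset.sum_nbij (extendFilling κ μ) ?_ ?_ ?_ ?_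
  · intro T hT
    have hT := (Finset.mem_filter.1 hT).2
    have hE := hT.extendFilling hs
    simp only [Finset.mem_filter, Finset.mem_univ, true_and]
    refine ⟨hE, ?_⟩
    rw [ht _ hE]
    ext c
    simp only [YoungDiagram.mem_cells, mem_truncation, extendFilling]
    constructor
    · rintro ⟨_, h⟩
      by_contra hc
      exact h (dif_neg hc)
    · intro hc
      refine ⟨hs.1 hc, ?_⟩
      rw [dif_pos hc]
      exact (Fin.castSucc_lt_last _).ne
  · intro T _ T' _ h
    funext c
    have := congrFun h ⟨c, hs.1 c.2⟩
    simpa only [extendFilling, dif_pos c.2, Fin.castSucc_inj] using this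
  · intro T hT
    simp only [Finset.coe_filter, Finset.mem_filter, Finset.mem_univ, true_and,
      Set.mem_ofPred_eq] at hT
    obtain ⟨hT, rfl⟩ := hT
    rw [ht T hT] at hs ⊢
    have hm : ∀ c : (truncation T hT).cells, (c : ℕ × ℕ) ∈ μ.cells := fun c => hs.1 c.2
    have hn : ∀ c : (truncation T hT).cells, T ⟨c, hm c⟩ ≠ Fin.last n := fun c =>
      (mem_truncation.1 c.2).2
    refine ⟨fun c => (T ⟨c, hm c⟩).castPred (hn c), ?_, ?_⟩
    · simp only [Finset.coe_filter, Finset.mem_univ, true_and, Set.mem_ofPred_eq]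
      refine ⟨fun a b h1 h2 => ?_, fun a b h1 h2 => ?_⟩
      · exact Fin.castPred_le_castPred_iff.2 (hT.1 ⟨a, hm a⟩ ⟨b, hm b⟩ h1 h2)
      · exact Fin.castPred_lt_castPred_iff.2 (hT.2 ⟨a, hm a⟩ ⟨b, hm b⟩ h1 h2)
    · funext c
      simp only [extendFilling]
      split_ifs with h
      · simp
      · by_contra hc
        exact h (mem_truncation.2 ⟨c.2, fun h => hc h.symm⟩)
  · intro T _
    exact (prod_extendFilling T hs.1 x).symm

/-- The Young diagram whose `i`-th row has length `a i`, for antitone `a`. -/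
def ofRows {n : ℕ} (a : Fin n → ℕ) : YoungDiagram where
  cells := (Finset.range n ×ˢ Finset.range (∑ i, a i)).filter
    fun p => ∀ i : Fin n, (i : ℕ) ≤ p.1 → p.2 < a i
  isLowerSet := by
    intro p q hle hp
    simp only [Finset.coe_filter, Finset.mem_product, Finset.mem_range,
      Set.mem_ofPred_eq] at hp ⊢
    exact ⟨⟨hle.1.trans_lt hp.1.1, hle.2.trans_lt hp.1.2⟩,
      fun i hi => hle.2.trans_lt (hp.2 i (hi.trans hle.1))⟩

lemma mem_ofRows {n : ℕ} {a : Fin n → ℕ} (ha : Antitone a) {i j : ℕ} :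
    (i, j) ∈ ofRows a ↔ ∃ h : i < n, j < a ⟨i, h⟩ := by
  rw [← YoungDiagram.mem_cells]
  simp only [ofRows, Finset.mem_filter, Finset.mem_product, Finset.mem_range]
  constructor
  · rintro ⟨⟨h, -⟩, h'⟩
    exact ⟨h, h' ⟨i, h⟩ le_rfl⟩
  · rintro ⟨h, h'⟩
    refine ⟨⟨h, h'.trans_le ?_⟩, fun k hk => h'.trans_le (ha (Fin.le_def.2 hk))⟩
    exact Finset.single_le_sum (fun _ _ => Nat.zero_le _) (Finset.mem_univ (⟨i, h⟩ : Fin n))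

lemma rowLen_ofRows {n : ℕ} {a : Fin n → ℕ} (ha : Antitone a) (i : Fin n) :
    (ofRows a).rowLen i = a i := by
  refine eq_of_forall_lt_iff fun j => ?_
  rw [← YoungDiagram.mem_iff_lt_rowLen, mem_ofRows ha]
  simp

lemma antitone_rowLen (μ : YoungDiagram) (n : ℕ) : Antitone fun i : Fin n => μ.rowLen i :=
  fun i j h => μ.rowLen_anti i j h

lemma ofRows_rowLen {μ : YoungDiagram} {n : ℕ} (h : (n, 0) ∉ μ) :
    ofRows (fun i : Fin n => μ.rowLen i) = μ := by
  ext ⟨i, j⟩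
  simp only [YoungDiagram.mem_cells, mem_ofRows (antitone_rowLen μ n),
    ← YoungDiagram.mem_iff_lt_rowLen, exists_prop, and_iff_right_iff_imp]
  intro hij
  by_contra hi
  exact h (μ.up_left_mem (not_lt.1 hi) (Nat.zero_le j) hij)

lemma notMem_ofRows {n : ℕ} {a : Fin n → ℕ} (ha : Antitone a) (j : ℕ) :
    (n, j) ∉ ofRows a := by
  simp [mem_ofRows ha]

lemma injOn_ofRows (n : ℕ) : Set.InjOn (ofRows (n := n)) {a | Antitone a} := by
  intro a ha b hb h
  funext i
  rw [← rowLen_ofRows ha, ← rowLen_ofRows hb, h]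

lemma card_ofRows {n : ℕ} {a : Fin n → ℕ} (ha : Antitone a) :
    (ofRows a).card = ∑ i, a i := by
  have h : ∀ c ∈ (ofRows a).cells, c.1 ∈ Finset.range n := fun c hc =>
    Finset.mem_range.2 ((mem_ofRows ha).1 hc).1
  rw [YoungDiagram.card, Finset.card_eq_sum_card_fiberwise h, Finset.sum_range]
  refine Finset.sum_congr rfl fun i _ => ?_
  rw [← rowLen_ofRows ha, YoungDiagram.rowLen_eq_card, YoungDiagram.row]

lemma card_transpose (μ : YoungDiagram) : μ.transpose.card = μ.card := by
  simp [YoungDiagram.card, YoungDiagram.transpose]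

lemma antitone_of_interlacing {n : ℕ} {a : Fin (n + 1) → ℕ} (ha : Antitone a) {c : Fin n → ℕ}
    (hc : ∀ i, a i.succ ≤ c i ∧ c i ≤ a i.castSucc) : Antitone c := by
  intro i j hij
  rcases hij.lt_or_eq with h | rfl
  · exact (hc j).2.trans ((ha (Fin.succ_le_castSucc_iff.2 h)).trans (hc i).1)
  · exact le_rfl

/-- Branching rule for Schur polynomials in terms of row lengths. -/
theorem schur_ofRows_succ {n : ℕ} {a : Fin (n + 1) → ℕ} (ha : Antitone a)
    (x : Fin (n + 1) → ℚ) :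
    schur (ofRows a) x =
      ∑ c ∈ Fintype.piFinset fun i : Fin n => Finset.Icc (a i.succ) (a i.castSucc),
        schur (ofRows c) (fun i => x i.castSucc) *
          ((∏ i, x (Fin.last n) ^ (a i.castSucc - c i)) * x (Fin.last n) ^ a (Fin.last n)) := by
  rw [schur_succ]
  symm
  refine Finset.sum_nbij ofRows ?_ ?_ ?_ ?_
  · intro c hc
    simp only [Fintype.mem_piFinset, Finset.mem_Icc] at hc
    have hca := antitone_of_interlacing ha hc
    refine mem_stripRemovals.2 ⟨⟨?_, fun i j h => ?_⟩, notMem_ofRows hca 0⟩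
    · rintro ⟨i, j⟩ h
      obtain ⟨hi, hj⟩ := (mem_ofRows hca).1 h
      exact (mem_ofRows ha).2 ⟨Nat.lt_succ_of_lt hi, hj.trans_le (hc ⟨i, hi⟩).2⟩
    · obtain ⟨hi, hj⟩ := (mem_ofRows ha).1 h
      exact (mem_ofRows hca).2 ⟨Nat.lt_of_succ_lt_succ hi,
        hj.trans_le (hc ⟨i, Nat.lt_of_succ_lt_succ hi⟩).1⟩
  · intro c hc d hd h
    simp only [Finset.mem_coe, Fintype.mem_piFinset, Finset.mem_Icc] at hc hd
    exact injOn_ofRows n (antitone_of_interlacing ha hc) (antitone_of_interlacing ha hd) h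
  · intro κ hκ
    obtain ⟨⟨hle, hs⟩, hn⟩ := mem_stripRemovals.1 hκ
    refine ⟨fun i => κ.rowLen i, ?_, ofRows_rowLen hn⟩
    simp only [Finset.mem_coe, Fintype.mem_piFinset, Finset.mem_Icc]
    refine fun i => ⟨le_of_forall_lt fun j hj => ?_, le_of_forall_lt fun j hj => ?_⟩
    · exact YoungDiagram.mem_iff_lt_rowLen.1 (hs i j ((mem_ofRows ha).2 ⟨i.succ.2, hj⟩))
    · exact ((mem_ofRows ha).1 (hle (YoungDiagram.mem_iff_lt_rowLen.2 hj))).2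
  · intro c hc
    simp only [Fintype.mem_piFinset, Finset.mem_Icc] at hc
    have hca := antitone_of_interlacing ha hc
    rw [Finset.prod_pow_eq_pow_sum, ← pow_add, card_ofRows ha, card_ofRows hca,
      Fin.sum_univ_castSucc, Finset.sum_tsub_distrib _ fun i _ => (hc i).2,
      Nat.sub_add_comm (Finset.sum_le_sum fun i _ => (hc i).2)]

/-- Branching rule for Schur polynomials in terms of column lengths. -/
theorem schur_transpose_ofRows_succ {f n : ℕ} {a : Fin f → ℕ} (ha : Antitone a)
    (x : Fin (n + 1) → ℚ) :
    schur (ofRows a).transpose x =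
      ∑ b ∈ (Fintype.piFinset fun i => Finset.Icc (a i - 1) (a i)) with
          Antitone b ∧ ∀ i, b i ≤ n,
        schur (ofRows b).transpose (fun i => x i.castSucc) *
          ∏ i, x (Fin.last n) ^ (a i - b i) := by
  rw [schur_succ]
  symm
  refine Finset.sum_nbij (fun b => (ofRows b).transpose) ?_ ?_ ?_ ?_
  · intro b hb
    simp only [Finset.mem_filter, Fintype.mem_piFinset, Finset.mem_Icc] at hb
    obtain ⟨hb, hba, hbn⟩ := hb
    refine mem_stripRemovals.2 ⟨⟨?_, fun i j h => ?_⟩, fun h => ?_⟩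
    · refine YoungDiagram.transpose_mono ?_
      rintro ⟨i, j⟩ h
      obtain ⟨hi, hj⟩ := (mem_ofRows hba).1 h
      exact (mem_ofRows ha).2 ⟨hi, hj.trans_le (hb ⟨i, hi⟩).2⟩
    · rw [YoungDiagram.mem_transpose] at h ⊢
      obtain ⟨hi, hj⟩ := (mem_ofRows ha).1 h
      have hj : i + 1 < a ⟨j, hi⟩ := hj
      have := (hb ⟨j, hi⟩).1
      exact (mem_ofRows hba).2 ⟨hi, show i < b ⟨j, hi⟩ by omega⟩
    · rw [YoungDiagram.mem_transpose] at h
      obtain ⟨hi, hj⟩ := (mem_ofRows hba).1 h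
      exact (hbn _).not_gt hj
  · intro c hc d hd h
    simp only [Finset.coe_filter, Set.mem_ofPred_eq] at hc hd
    exact injOn_ofRows f hc.2.1 hd.2.1 (YoungDiagram.transpose_eq_iff.1 h)
  · intro κ hκ
    obtain ⟨⟨hle, hs⟩, hn⟩ := mem_stripRemovals.1 hκ
    have hle' : κ.transpose ≤ ofRows a := by
      simpa using YoungDiagram.transpose_mono hle
    refine ⟨fun i => κ.transpose.rowLen i, ?_, ?_⟩
    · simp only [Finset.coe_filter, Set.mem_ofPred_eq, Fintype.mem_piFinset, Finset.mem_Icc]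
      refine ⟨fun i => ⟨le_of_forall_lt fun j hj => ?_, le_of_forall_lt fun j hj => ?_⟩,
        antitone_rowLen _ f, fun i => le_of_forall_lt fun j hj => ?_⟩
      · refine YoungDiagram.mem_iff_lt_rowLen.1 (YoungDiagram.mem_transpose.2 (hs j i ?_))
        exact YoungDiagram.mem_transpose.2 ((mem_ofRows ha).2 ⟨i.2, by simp; omega⟩)
      · exact ((mem_ofRows ha).1 (hle' (YoungDiagram.mem_iff_lt_rowLen.2 hj))).2
      · have h := YoungDiagram.mem_transpose.1 (YoungDiagram.mem_iff_lt_rowLen.2 hj)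
        by_contra hjn
        exact hn (κ.up_left_mem (not_lt.1 hjn) (Nat.zero_le _) h)
    · rw [YoungDiagram.transpose_eq_iff_eq_transpose]
      exact ofRows_rowLen fun h => notMem_ofRows ha 0 (hle' h)
  · intro b hb
    simp only [Finset.mem_filter, Fintype.mem_piFinset, Finset.mem_Icc] at hb
    rw [Finset.prod_pow_eq_pow_sum, card_transpose, card_transpose, card_ofRows ha,
      card_ofRows hb.2.1, Finset.sum_tsub_distrib _ fun i _ => (hb.1 i).2]

/-- The weight of the admissible values `b ∈ {a, a + 1}` with `k ≤ b ≤ u`. -/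
def raiseWeight (x y : ℚ) (a k u : ℕ) : ℚ :=
  ∑ b ∈ Finset.Icc a (a + 1), if k ≤ b ∧ b ≤ u then y ^ (b - k) * x ^ (a + 1 - b) else 0

/-- The weight of the admissible values `c ∈ [a', a]` with `c ≤ k ≤ c + 1`. -/
def lowerWeight (x y : ℚ) (a a' k : ℕ) : ℚ :=
  ∑ c ∈ Finset.Icc a' a, if c ≤ k ∧ k ≤ c + 1 then y ^ (a - c) * x ^ (c + 1 - k) else 0

/-- The boundary factor `x + y`, with each term subject to the upper bound `u`. -/
def boundWeight (x y : ℚ) (a u : ℕ) : ℚ :=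
  (if a ≤ u then x else 0) + if a + 1 ≤ u then y else 0

lemma raiseWeight_eq (x y : ℚ) (a k u : ℕ) :
    raiseWeight x y a k u = (if k ≤ a ∧ a ≤ u then y ^ (a - k) * x else 0) +
      if k ≤ a + 1 ∧ a + 1 ≤ u then y ^ (a + 1 - k) else 0 := by
  have : Finset.Icc a (a + 1) = {a, a + 1} := by
    ext b
    simp only [Finset.mem_Icc, Finset.mem_insert, Finset.mem_singleton]
    omega
  rw [raiseWeight, this, Finset.sum_pair (by omega)]
  simp

lemma lowerWeight_eq (x y : ℚ) {a a' k : ℕ} :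
    lowerWeight x y a a' k = (if a' ≤ k ∧ k ≤ a then y ^ (a - k) * x else 0) +
      if a' + 1 ≤ k ∧ k ≤ a + 1 then y ^ (a + 1 - k) else 0 := by
  have h : ∀ c, (if c ≤ k ∧ k ≤ c + 1 then y ^ (a - c) * x ^ (c + 1 - k) else 0) =
      (if k = c then y ^ (a - k) * x else 0) +
        if k = c + 1 then y ^ (a + 1 - k) else 0 := by
    intro c
    rcases eq_or_ne k c with rfl | h1
    · simp
    rcases eq_or_ne k (c + 1) with rfl | h2
    · simp
    rw [if_neg (by omega), if_neg h1, if_neg h2, add_zero]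
  simp only [lowerWeight, h, Finset.sum_add_distrib]
  congr 1
  · rw [Finset.sum_ite_eq]
    simp [Finset.mem_Icc]
  · cases k with
    | zero => simp
    | succ k =>
      simp only [add_left_inj]
      rw [Finset.sum_ite_eq]
      simp [Finset.mem_Icc]

lemma raiseWeight_mul_boundWeight (x y : ℚ) {a a' k u : ℕ} (ha : a' ≤ a) (hk : k ≤ u) :
    raiseWeight x y a k u * boundWeight x y a' k =
      boundWeight x y a u * lowerWeight x y a a' k := by
  rw [raiseWeight_eq, lowerWeight_eq, boundWeight, boundWeight]
  rcases lt_trichotomy k (a + 1) with h | rfl | h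
  · have hka : k ≤ a := Nat.lt_succ_iff.1 h
    simp only [hka, hka.trans (Nat.le_succ a), true_and, and_true, Nat.succ_sub hka, pow_succ]
    split_ifs <;> ring
  · rw [if_neg (by omega), if_pos (by omega), if_pos (by omega), if_pos (by omega),
      if_pos (by omega), if_pos (by omega), if_neg (by omega), if_pos (by omega)]
    simp
  · rw [if_neg (by omega), if_neg (by omega), if_neg (by omega : ¬(a' ≤ k ∧ k ≤ a)),
      if_neg (by omega : ¬(a' + 1 ≤ k ∧ k ≤ a + 1))]
    simp

lemma prod_raiseWeight (x y : ℚ) {n : ℕ} {a : Fin (n + 1) → ℕ} (ha : Antitone a)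
    {k : Fin n → ℕ} (hk : Antitone k) {u : ℕ} (hu : ∀ i, k i ≤ u) :
    ∏ j, raiseWeight x y (a j) (Fin.snoc (α := fun _ => ℕ) k 0 j)
        (Fin.cons (α := fun _ => ℕ) u k j) =
      boundWeight x y (a 0) u *
        ((∏ i, lowerWeight x y (a i.castSucc) (a i.succ) (k i)) * y ^ a (Fin.last n)) := by
  induction n generalizing u with
  | zero =>
    simp [raiseWeight_eq, boundWeight, Fin.snoc]
    split_ifs <;> ring
  | succ n ih =>
    have h := ih (a := Fin.tail a) (fun i j hij => ha (Fin.succ_le_succ_iff.2 hij))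
      (k := Fin.tail k) (fun i j hij => hk (Fin.succ_le_succ_iff.2 hij)) (u := k 0)
      (fun i => hk (Fin.zero_le _))
    have hs : ∀ j : Fin (n + 1), (Fin.snoc (α := fun _ => ℕ) k 0 : Fin (n + 2) → ℕ) j.succ =
        Fin.snoc (α := fun _ => ℕ) (Fin.tail k) 0 j := by
      intro j
      refine Fin.lastCases ?_ (fun j => ?_) j
      · rw [Fin.succ_last, Fin.snoc_last, Fin.snoc_last]
      · rw [Fin.succ_castSucc, Fin.snoc_castSucc, Fin.snoc_castSucc, Fin.tail]
    have hc : (Fin.cons (α := fun _ => ℕ) (k 0) (Fin.tail k) : Fin (n + 1) → ℕ) = k :=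
      Fin.cons_self_tail k
    have h0 : (Fin.snoc (α := fun _ => ℕ) k 0 : Fin (n + 2) → ℕ) 0 = k 0 :=
      Fin.snoc_castSucc (α := fun _ => ℕ) 0 k 0
    rw [hc] at h
    rw [Fin.prod_univ_succ]
    simp only [Fin.cons_zero, Fin.cons_succ, hs, h0]
    rw [show ∏ j : Fin (n + 1), raiseWeight x y (a j.succ)
      (Fin.snoc (α := fun _ => ℕ) (Fin.tail k) 0 j) (k j) = _ from h, ← mul_assoc]
    rw [show Fin.tail a 0 = a 1 from rfl,
      raiseWeight_mul_boundWeight x y (ha (Fin.zero_le 1)) (hu 0), Fin.prod_univ_succ]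
    simp only [Fin.tail, Fin.castSucc_zero, Fin.succ_zero_eq_one, Fin.succ_castSucc, Fin.succ_last]
    ring

/-- Exchange identity for a horizontal strip followed by a vertical strip. -/
lemma sum_strip_exchange (x y : ℚ) {n : ℕ} {a : Fin (n + 1) → ℕ} (ha : Antitone a)
    {k : Fin n → ℕ} (hk : Antitone k) :
    (x + y) * ∑ c ∈ Fintype.piFinset fun i : Fin n => Finset.Icc (a i.succ) (a i.castSucc),
        (if ∀ i, c i ≤ k i ∧ k i ≤ c i + 1 then
          ((∏ i, y ^ (a i.castSucc - c i)) * y ^ a (Fin.last n)) *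
            ∏ i, x ^ (c i + 1 - k i) else 0) =
      ∑ b ∈ Fintype.piFinset fun i => Finset.Icc (a i) (a i + 1),
        if ∀ i : Fin n, b i.succ ≤ k i ∧ k i ≤ b i.castSucc then
          ((∏ i : Fin n, y ^ (b i.castSucc - k i)) * y ^ b (Fin.last n)) *
            ∏ i, x ^ (a i + 1 - b i) else 0 := by
  have hku : ∀ i, k i ≤ a 0 + 1 + ∑ i, k i := fun i =>
    (Finset.single_le_sum (fun _ _ => Nat.zero_le _) (Finset.mem_univ i)).trans
      (Nat.le_add_left _ _)
  set u := a 0 + 1 + ∑ i, k i with hu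
  have key := prod_raiseWeight x y ha hk hku
  have hb : boundWeight x y (a 0) u = x + y := by
    rw [boundWeight, if_pos (by omega), if_pos (by omega)]
  rw [hb] at key
  simp only [raiseWeight, lowerWeight, Finset.prod_univ_sum] at key
  rw [Finset.sum_mul] at key
  refine Eq.trans ?_ (key.symm.trans ?_)
  · congr 1
    refine Finset.sum_congr rfl fun c _ => ?_
    rw [Finset.prod_ite_zero]
    simp only [Finset.mem_univ, true_imp_iff]
    split_ifs with h
    · rw [Finset.prod_mul_distrib]; ring
    · simp
  · refine Finset.sum_congr rfl fun b hb => ?_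
    simp only [Fintype.mem_piFinset, Finset.mem_Icc] at hb
    rw [Finset.prod_ite_zero]
    simp only [Finset.mem_univ, true_imp_iff]
    have hiff : (∀ i, Fin.snoc (α := fun _ => ℕ) k 0 i ≤ b i ∧
        b i ≤ Fin.cons (α := fun _ => ℕ) u k i) ↔
        ∀ i : Fin n, b i.succ ≤ k i ∧ k i ≤ b i.castSucc := by
      rw [forall_and, forall_and, Fin.forall_fin_succ',
        Fin.forall_fin_succ (P := fun i => b i ≤ _)]
      have := (hb 0).2
      have : b 0 ≤ u := by omega
      simp [this, and_comm]
    simp only [hiff]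
    split_ifs with h
    · rw [Finset.prod_mul_distrib, Fin.prod_univ_castSucc]
      simp
    · rfl

/-- Dual Pieri rule, with the generating function of all elementary symmetric polynomials. -/
theorem schur_mul_prod_add (x : ℚ) {n : ℕ} {a : Fin n → ℕ} (ha : Antitone a) (y : Fin n → ℚ) :
    schur (ofRows a) y * ∏ j, (x + y j) =
      ∑ b ∈ (Fintype.piFinset fun i => Finset.Icc (a i) (a i + 1)) with Antitone b,
        schur (ofRows b) y * ∏ i, x ^ (a i + 1 - b i) := by
  induction n with
  | zero =>
    have h : (Fintype.piFinset fun i => Finset.Icc (a i) (a i + 1)).filter Antitone = {a} := by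
      ext b
      obtain rfl : b = a := Subsingleton.elim b a
      simp [ha, eq_iff_true_of_subsingleton]
    rw [h]
    simp
  | succ n ih =>
    let K : Finset (Fin n → ℕ) :=
      (Fintype.piFinset fun i : Fin n => Finset.Iic (a i.castSucc + 1)).filter Antitone
    let Y := y (Fin.last n)
    let s : (Fin n → ℕ) → ℚ := fun k => schur (ofRows k) fun i => y i.castSucc
    have hK : ∀ k ∈ K, Antitone k := fun k hk => (Finset.mem_filter.1 hk).2
    have hl : schur (ofRows a) y * ∏ j, (x + y j) = ∑ k ∈ K, s k * ((x + Y) *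
        ∑ c ∈ Fintype.piFinset fun i : Fin n => Finset.Icc (a i.succ) (a i.castSucc),
          (if ∀ i, c i ≤ k i ∧ k i ≤ c i + 1 then
            ((∏ i, Y ^ (a i.castSucc - c i)) * Y ^ a (Fin.last n)) *
              ∏ i, x ^ (c i + 1 - k i) else 0)) := by
      rw [schur_ofRows_succ ha, Fin.prod_univ_castSucc]
      simp only [Finset.mul_sum, Finset.sum_mul]
      rw [Finset.sum_comm]
      refine Finset.sum_congr rfl fun c hc => ?_
      simp only [Fintype.mem_piFinset, Finset.mem_Icc] at hc
      have hca := antitone_of_interlacing ha hc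
      have hf : (Fintype.piFinset fun i => Finset.Icc (c i) (c i + 1)).filter Antitone =
          K.filter fun k => ∀ i, c i ≤ k i ∧ k i ≤ c i + 1 := by
        ext k
        simp only [K, Finset.mem_filter, Fintype.mem_piFinset, Finset.mem_Icc, Finset.mem_Iic]
        constructor
        · rintro ⟨h1, h2⟩
          exact ⟨⟨fun i => (h1 i).2.trans (Nat.succ_le_succ (hc i).2), h2⟩, h1⟩
        · rintro ⟨⟨-, h2⟩, h1⟩
          exact ⟨h1, h2⟩
      have h := ih hca fun i => y i.castSucc
      rw [hf, Finset.sum_filter] at h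
      calc _ = (schur (ofRows c) (fun i => y i.castSucc) * ∏ i : Fin n, (x + y i.castSucc)) *
            ((x + Y) * ((∏ i, Y ^ (a i.castSucc - c i)) * Y ^ a (Fin.last n))) := by ring
        _ = _ := by
          rw [h, Finset.sum_mul]
          refine Finset.sum_congr rfl fun k _ => ?_
          split_ifs
          · ring
          · ring
    rw [hl, Finset.sum_congr rfl fun k hk => by rw [sum_strip_exchange x Y ha (hK k hk)]]
    simp only [Finset.mul_sum]
    rw [Finset.sum_comm, Finset.sum_filter (p := Antitone)]
    refine Finset.sum_congr rfl fun b hb => ?_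
    simp only [Fintype.mem_piFinset, Finset.mem_Icc] at hb
    split_ifs with hba
    · have hf : (Fintype.piFinset fun i : Fin n => Finset.Icc (b i.succ) (b i.castSucc)) =
          K.filter fun k => ∀ i : Fin n, b i.succ ≤ k i ∧ k i ≤ b i.castSucc := by
        ext k
        simp only [K, Finset.mem_filter, Fintype.mem_piFinset, Finset.mem_Icc, Finset.mem_Iic]
        refine ⟨fun h => ⟨⟨fun i => (h i).2.trans (hb _).2, antitone_of_interlacing hba h⟩, h⟩,
          fun h => h.2⟩
      rw [schur_ofRows_succ hba, hf,
        Finset.sum_filter (p := fun k : Fin n → ℕ => ∀ i : Fin n, b i.succ ≤ k i ∧ k i ≤ b i.castSucc),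
        Finset.sum_mul]
      refine Finset.sum_congr rfl fun k _ => ?_
      split_ifs
      · ring
      · ring
    · refine Finset.sum_eq_zero fun k hk => ?_
      rw [if_neg, mul_zero]
      exact fun h => hba (Fin.antitone_iff_succ_le.2 fun i => (h i).1.trans (h i).2)

/-- The weakly decreasing sequences of length `f` with entries at most `e`. -/
def boundedAntitone (e f : ℕ) : Finset (Fin f → ℕ) :=
  (Fintype.piFinset fun _ => Finset.Iic e).filter Antitone

lemma mem_boundedAntitone {e f : ℕ} {a : Fin f → ℕ} :
    a ∈ boundedAntitone e f ↔ (∀ i, a i ≤ e) ∧ Antitone a := by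
  simp [boundedAntitone]

lemma antitone_sub_rev {f : ℕ} {a : Fin f → ℕ} (ha : Antitone a) (e : ℕ) :
    Antitone fun j : Fin f => e - a j.rev :=
  fun _ _ h => Nat.sub_le_sub_left (ha (Fin.rev_le_rev.2 h)) e

/-- The dual Pieri rule for the complement of `b` in a rectangle, indexed by complements. -/
lemma schur_compl_mul_prod_add (x : ℚ) {e f : ℕ} {b : Fin f → ℕ} (hb : b ∈ boundedAntitone e f)
    (y : Fin f → ℚ) :
    schur (ofRows fun j : Fin f => e - b j.rev) y * ∏ j, (x + y j) =
      ∑ a ∈ (Fintype.piFinset fun i => Finset.Icc (b i) (b i + 1)) with Antitone a,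
        schur (ofRows fun j : Fin f => e + 1 - a j.rev) y * ∏ i, x ^ (a i - b i) := by
  obtain ⟨hbe, hb⟩ := mem_boundedAntitone.1 hb
  rw [schur_mul_prod_add x (antitone_sub_rev hb e)]
  refine Finset.sum_nbij' (fun c j => e + 1 - c j.rev) (fun a j => e + 1 - a j.rev) ?_ ?_ ?_ ?_ ?_
  · intro c hc
    simp only [Finset.mem_filter, Fintype.mem_piFinset, Finset.mem_Icc] at hc ⊢
    refine ⟨fun i => ?_, antitone_sub_rev hc.2 _⟩
    have h1 := hc.1 i.rev
    have h2 := hbe i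
    rw [Fin.rev_rev] at h1
    omega
  · intro a ha
    simp only [Finset.mem_filter, Fintype.mem_piFinset, Finset.mem_Icc] at ha ⊢
    refine ⟨fun i => ?_, antitone_sub_rev ha.2 _⟩
    have h1 := ha.1 i.rev
    have h2 := hbe i.rev
    omega
  · intro c hc
    simp only [Finset.mem_filter, Fintype.mem_piFinset, Finset.mem_Icc] at hc
    funext i
    have h1 := hc.1 i
    have h2 := hbe i.rev
    simp only [Fin.rev_rev]
    omega
  · intro a ha
    simp only [Finset.mem_filter, Fintype.mem_piFinset, Finset.mem_Icc] at ha
    funext i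
    have h1 := ha.1 i
    have h2 := hbe i
    simp only [Fin.rev_rev]
    omega
  · intro c hc
    simp only [Finset.mem_filter, Fintype.mem_piFinset, Finset.mem_Icc] at hc
    have hcc : (fun j : Fin f => e + 1 - (e + 1 - c j.rev.rev)) = c := by
      funext i
      have h1 := hc.1 i
      have h2 := hbe i.rev
      simp only [Fin.rev_rev]
      omega
    rw [hcc]
    congr 1
    refine Fintype.prod_equiv Fin.revPerm _ _ fun i => ?_
    have h1 := hc.1 i
    have h2 := hbe i.rev
    simp only [Fin.revPerm_apply, Fin.rev_rev]
    congr 1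
    omega

/-- The dual Cauchy identity in terms of column lengths. -/
theorem prod_add_eq_sum_boundedAntitone (e f : ℕ) (x : Fin e → ℚ) (y : Fin f → ℚ) :
    ∏ i, ∏ j, (x i + y j) = ∑ a ∈ boundedAntitone e f,
      schur (ofRows a).transpose x * schur (ofRows fun j : Fin f => e - a j.rev) y := by
  induction e with
  | zero =>
    have hbot : ofRows (fun _ : Fin f => 0) = ⊥ := by
      ext ⟨i, j⟩
      simp [mem_ofRows antitone_const]
    have h : boundedAntitone 0 f = {fun _ => 0} := by
      ext a
      simp only [mem_boundedAntitone, Nat.le_zero, Finset.mem_singleton, funext_iff]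
      exact ⟨fun h => h.1, fun h => ⟨h, fun i j _ => by rw [h i, h j]⟩⟩
    simp only [h, Finset.sum_singleton, Nat.sub_self]
    rw [hbot,
      YoungDiagram.transpose_eq_iff_eq_transpose.2 (show ⊥ = (⊥ : YoungDiagram).transpose from ?_),
      schur_bot, schur_bot]
    · simp
    · ext c
      simp
  | succ e ih =>
    rw [Fin.prod_univ_castSucc, ih, Finset.sum_mul]
    simp only [mul_assoc]
    rw [Finset.sum_congr rfl fun b hb => by
        rw [schur_compl_mul_prod_add _ hb, Finset.mul_sum]]
    symm
    rw [Finset.sum_congr rfl fun a ha => by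
        rw [schur_transpose_ofRows_succ (mem_boundedAntitone.1 ha).2, Finset.sum_mul]]
    symm
    rw [Finset.sum_comm' (t' := boundedAntitone (e + 1) f) (s' := fun a =>
      (Fintype.piFinset fun i => Finset.Icc (a i - 1) (a i)).filter
        fun b => Antitone b ∧ ∀ i, b i ≤ e)]
    · refine Finset.sum_congr rfl fun a _ => Finset.sum_congr rfl fun b _ => ?_
      ring
    · intro b a
      simp only [mem_boundedAntitone, Finset.mem_filter, Fintype.mem_piFinset, Finset.mem_Icc]
      constructor
      · rintro ⟨⟨h1, h2⟩, h3, h4⟩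
        refine ⟨⟨fun i => ?_, h2, h1⟩, fun i => ?_, h4⟩
        · have := h3 i
          omega
        · have := h3 i
          have := h1 i
          omega
      · rintro ⟨⟨h1, h2, h3⟩, h4, h5⟩
        refine ⟨⟨h3, h2⟩, fun i => ?_, h5⟩
        have := h1 i
        omega

lemma rectCompl_transpose_ofRows {e f : ℕ} {a : Fin f → ℕ} (ha : Antitone a) :
    rectCompl e f (ofRows a).transpose = ofRows fun j : Fin f => e - a j.rev := by
  ext ⟨i, j⟩
  simp only [YoungDiagram.mem_cells, mem_ofRows (antitone_sub_rev ha e)]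
  rw [← YoungDiagram.mem_cells, rectCompl, complIn, YoungDiagram.transpose_transpose]
  simp only [Finset.mem_filter, Finset.mem_product, Finset.mem_range, mem_ofRows ha, not_exists,
    not_lt]
  constructor
  · rintro ⟨⟨hi, hj⟩, h⟩
    refine ⟨hi, ?_⟩
    have h := h (by omega)
    have hr : (⟨i, hi⟩ : Fin f).rev = ⟨f - 1 - i, by omega⟩ := Fin.ext (by simp; omega)
    rw [hr]
    omega
  · rintro ⟨hi, h⟩
    have hr : (⟨i, hi⟩ : Fin f).rev = ⟨f - 1 - i, by omega⟩ := Fin.ext (by simp; omega)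
    rw [hr] at h
    exact ⟨⟨hi, by omega⟩, fun _ => by omega⟩

/-- `∏_{i,j}(xᵢ + yⱼ) = ∑_{λ ⊆ e×f} s_λ(x)·s_{e×f−λ̃}(y)`. -/
theorem cauchy_complement_identity (e f : ℕ) (x : Fin e → ℚ) (y : Fin f → ℚ) :
    (∏ i, ∏ j, (x i + y j)) =
    ∑ᶠ lam : YoungDiagram,
      if lam.rowLen 0 ≤ f ∧ lam.colLen 0 ≤ e then
        schur lam x * schur (rectCompl e f lam) y else 0 := by
  rw [prod_add_eq_sum_boundedAntitone]
  have hinj : Set.InjOn (fun a : Fin f → ℕ => (ofRows a).transpose) (boundedAntitone e f) := by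
    intro a ha b hb h
    exact injOn_ofRows f (mem_boundedAntitone.1 ha).2 (mem_boundedAntitone.1 hb).2
      (YoungDiagram.transpose_eq_iff.1 h)
  have hbox : ∀ lam : YoungDiagram, lam.rowLen 0 ≤ f ∧ lam.colLen 0 ≤ e ↔
      lam ∈ (boundedAntitone e f).image fun a => (ofRows a).transpose := by
    intro lam
    simp only [Finset.mem_image, mem_boundedAntitone]
    constructor
    · rintro ⟨h1, h2⟩
      refine ⟨fun i => lam.transpose.rowLen i, ⟨fun i => ?_, antitone_rowLen _ f⟩, ?_⟩
      · refine (YoungDiagram.rowLen_transpose lam i).trans_le ?_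
        exact (lam.colLen_anti 0 i (Nat.zero_le _)).trans h2
      · rw [ofRows_rowLen, YoungDiagram.transpose_transpose]
        rw [YoungDiagram.mem_iff_lt_colLen, YoungDiagram.colLen_transpose]
        exact h1.not_gt
    · rintro ⟨a, ⟨h1, h2⟩, rfl⟩
      rw [YoungDiagram.rowLen_transpose, YoungDiagram.colLen_transpose]
      refine ⟨not_lt.1 fun h => ?_, not_lt.1 fun h => ?_⟩
      · exact notMem_ofRows h2 0 (YoungDiagram.mem_iff_lt_colLen.2 h)
      · obtain ⟨h3, h4⟩ := (mem_ofRows h2).1 (YoungDiagram.mem_iff_lt_rowLen.2 h)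
        exact (h1 _).not_gt h4
  simp only [hbox]
  rw [finsum_eq_sum_of_support_subset (s := (boundedAntitone e f).image fun a =>
    (ofRows a).transpose), Finset.sum_image hinj]
  · refine Finset.sum_congr rfl fun a ha => ?_
    rw [if_pos (Finset.mem_image_of_mem _ ha),
      rectCompl_transpose_ofRows (mem_boundedAntitone.1 ha).2]
  · intro lam h
    by_contra hn
    exact h (if_neg hn)

end ChernTensor
end
end

section
/- The polynomials P_{λ,μ} satisfy the symmetry P_{λ,μ}(e,f) = P_{μ,λ}(f,e), as polynomials in e and f. -/
open scoped Classical BigOperators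
noncomputable section

namespace ChernTensor

/-- The number of cells of `a` in its first `p` rows. -/
def rowsCard (a : YoungDiagram) (p : ℕ) : ℕ :=
  (a.cells.filter (fun c => c.1 < p)).card

theorem rowsCard_zero (a : YoungDiagram) : rowsCard a 0 = 0 := by
  simp [rowsCard]

theorem rowsCard_succ (a : YoungDiagram) (p : ℕ) :
    rowsCard a (p + 1) = rowsCard a p + a.rowLen p := by
  rw [YoungDiagram.rowLen_eq_card, rowsCard, rowsCard, ← Finset.card_union_of_disjoint]
  · congr 1
    ext c
    simp only [Finset.mem_filter, Finset.mem_union, YoungDiagram.mem_row_iff,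
      YoungDiagram.mem_cells, ← and_or_left]
    exact and_congr_right fun _ => Nat.lt_succ_iff_lt_or_eq
  · rw [Finset.disjoint_left]
    intro c hc hc'
    rw [Finset.mem_filter] at hc
    rw [YoungDiagram.mem_row_iff] at hc'
    omega

theorem rowsCard_of_colLen_le {a : YoungDiagram} {p : ℕ} (hp : a.colLen 0 ≤ p) :
    rowsCard a p = a.card := by
  rw [rowsCard, Finset.filter_true_of_mem]
  intro c hc
  have h := YoungDiagram.up_left_mem a le_rfl (Nat.zero_le c.2)
    ((YoungDiagram.mem_cells (c.1, c.2)).1 hc)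
  exact (YoungDiagram.mem_iff_lt_colLen.1 h).trans_le hp

theorem rowsCard_mono {a b : YoungDiagram} (h : a ≤ b) (p : ℕ) :
    rowsCard a p ≤ rowsCard b p :=
  Finset.card_le_card (Finset.filter_subset_filter _ (YoungDiagram.cells_subset_iff.2 h))

theorem rowLen_eq_zero_of_colLen_le {a : YoungDiagram} {p : ℕ} (hp : a.colLen 0 ≤ p) :
    a.rowLen p = 0 := by
  by_contra h
  exact absurd (YoungDiagram.mem_iff_lt_colLen.1
    (YoungDiagram.mem_iff_lt_rowLen.2 (Nat.pos_of_ne_zero h))) (not_lt.2 hp)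

theorem ext_rowLen {a b : YoungDiagram} (h : ∀ r, a.rowLen r = b.rowLen r) : a = b := by
  refine SetLike.ext fun c => ?_
  rw [← Prod.mk.eta (p := c), YoungDiagram.mem_iff_lt_rowLen, YoungDiagram.mem_iff_lt_rowLen, h]

theorem rowLen_mono {a b : YoungDiagram} (h : a ≤ b) (r : ℕ) : a.rowLen r ≤ b.rowLen r := by
  by_contra! hlt
  exact lt_irrefl _ (YoungDiagram.mem_iff_lt_rowLen.1
    (h (YoungDiagram.mem_iff_lt_rowLen.2 hlt)))

theorem le_of_rowLen_le {a b : YoungDiagram} (h : ∀ r, a.rowLen r ≤ b.rowLen r) : a ≤ b := by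
  rintro ⟨i, j⟩ hc
  exact YoungDiagram.mem_iff_lt_rowLen.2 ((YoungDiagram.mem_iff_lt_rowLen.1 hc).trans_le (h i))

theorem card_mono {a b : YoungDiagram} (h : a ≤ b) : a.card ≤ b.card :=
  Finset.card_le_card (YoungDiagram.cells_subset_iff.2 h)

/-- `b / a` is a horizontal strip. -/
def IsHStrip (a b : YoungDiagram) : Prop :=
  a ≤ b ∧ ∀ i j, (i + 1, j) ∈ b → (i, j) ∈ a

theorem isHStrip_iff {a b : YoungDiagram} :
    IsHStrip a b ↔ ∀ r, a.rowLen r ≤ b.rowLen r ∧ b.rowLen (r + 1) ≤ a.rowLen r := by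
  constructor
  · rintro ⟨h, h'⟩ r
    refine ⟨rowLen_mono h r, ?_⟩
    by_contra! hlt
    exact lt_irrefl _ (YoungDiagram.mem_iff_lt_rowLen.1
      (h' _ _ (YoungDiagram.mem_iff_lt_rowLen.2 hlt)))
  · intro h
    refine ⟨le_of_rowLen_le fun r => (h r).1, fun i j hij => ?_⟩
    exact YoungDiagram.mem_iff_lt_rowLen.2
      ((YoungDiagram.mem_iff_lt_rowLen.1 hij).trans_le (h i).2)

theorem IsHStrip.refl (a : YoungDiagram) : IsHStrip a a :=
  ⟨le_rfl, fun i _ h => a.up_left_mem (Nat.le_succ i) le_rfl h⟩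

/-- The diagram whose row lengths are the given function, when the latter is antitone and
bounded by the row lengths of `b`. -/
def subRows (b : YoungDiagram) (g : ℕ → ℕ) : YoungDiagram :=
  ⟨b.cells.filter (fun c => ∀ i ≤ c.1, c.2 < g i), by
    intro c d hle hc
    simp only [Finset.coe_filter, Set.mem_ofPred_eq, YoungDiagram.mem_cells] at hc ⊢
    exact ⟨b.up_left_mem hle.1 hle.2 hc.1,
      fun i hi => hle.2.trans_lt (hc.2 i (hi.trans hle.1))⟩⟩

theorem rowLen_subRows {b : YoungDiagram} {g : ℕ → ℕ} (hg : Antitone g)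
    (hb : ∀ r, g r ≤ b.rowLen r) (r : ℕ) : (subRows b g).rowLen r = g r := by
  have key : ∀ j, j < (subRows b g).rowLen r ↔ j < g r := by
    intro j
    rw [← YoungDiagram.mem_iff_lt_rowLen, ← YoungDiagram.mem_cells]
    refine Finset.mem_filter.trans ?_
    rw [YoungDiagram.mem_cells, YoungDiagram.mem_iff_lt_rowLen]
    exact ⟨fun h => h.2 r le_rfl,
      fun h => ⟨h.trans_le (hb r), fun i hi => h.trans_le (hg hi)⟩⟩
  exact le_antisymm (le_of_not_gt fun h => lt_irrefl _ ((key _).1 h))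
    (le_of_not_gt fun h => lt_irrefl _ ((key _).2 h))

/-- Rows `g` interlace with the rows of `a` and `b`, i.e. insert between them as
horizontal strips. -/
def Interlaces (a b : YoungDiagram) (g : ℕ → ℕ) : Prop :=
  ∀ r, a.rowLen r ≤ g r ∧ b.rowLen (r + 1) ≤ g r ∧ g r ≤ b.rowLen r ∧ g (r + 1) ≤ a.rowLen r

theorem Interlaces.rowLen {a b : YoungDiagram} {g : ℕ → ℕ} (h : Interlaces a b g) (r : ℕ) :
    (subRows b g).rowLen r = g r :=
  rowLen_subRows (antitone_nat_of_succ_le fun r => (h r).2.2.2.trans (h r).1)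
    (fun r => (h r).2.2.1) r

theorem Interlaces.left {a b : YoungDiagram} {g : ℕ → ℕ} (h : Interlaces a b g) :
    IsHStrip a (subRows b g) := by
  rw [isHStrip_iff]
  intro r
  rw [h.rowLen, h.rowLen]
  exact ⟨(h r).1, (h r).2.2.2⟩

theorem Interlaces.right {a b : YoungDiagram} {g : ℕ → ℕ} (h : Interlaces a b g) :
    IsHStrip (subRows b g) b := by
  rw [isHStrip_iff]
  intro r
  rw [h.rowLen]
  exact ⟨(h r).2.2.1, (h r).2.1⟩

/-- The row lengths of the Bender–Knuth reflection of `b` between `a` and `c`. -/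
def reflRows (a b c : YoungDiagram) (s : ℕ) : ℕ :=
  max (a.rowLen s) (c.rowLen (s + 1)) +
    (if s = 0 then c.rowLen 0 else min (c.rowLen s) (a.rowLen (s - 1))) - b.rowLen s

/-- The Bender–Knuth reflection of `b` between `a` and `c`. -/
def refl (a b c : YoungDiagram) : YoungDiagram := subRows c (reflRows a b c)

section refl

variable {a b c : YoungDiagram}

theorem interlaces_reflRows (h : IsHStrip a b) (h' : IsHStrip b c) :
    Interlaces a c (reflRows a b c) := by
  rw [isHStrip_iff] at h h'
  intro r
  have h1 := h r
  have h2 := h' r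
  have h3 := h (r + 1)
  have h4 := h' (r + 1)
  have h5 := a.rowLen_anti r (r + 1) (Nat.le_succ r)
  have h6 := c.rowLen_anti (r + 1) (r + 2) (Nat.le_succ _)
  unfold reflRows
  rw [if_neg (Nat.succ_ne_zero r), Nat.add_sub_cancel]
  rcases r with _ | r
  · simp only [if_true]
    refine ⟨?_, ?_, ?_, ?_⟩ <;> omega
  · have h7 := h r
    have h8 := h' r
    rw [if_neg (Nat.succ_ne_zero r), Nat.add_sub_cancel]
    refine ⟨?_, ?_, ?_, ?_⟩ <;> omega

theorem refl_refl (h : IsHStrip a b) (h' : IsHStrip b c) : refl a (refl a b c) c = b := by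
  have hi := interlaces_reflRows h h'
  have hi' := interlaces_reflRows hi.left hi.right
  refine ext_rowLen fun r => ?_
  unfold refl
  rw [hi'.rowLen, reflRows, hi.rowLen, reflRows]
  rw [isHStrip_iff] at h h'
  have h1 := h r
  have h2 := h' r
  rcases r with _ | r
  · simp only [if_true]
    omega
  · have h7 := h r
    have h8 := h' r
    rw [if_neg (Nat.succ_ne_zero r), Nat.add_sub_cancel]
    omega

theorem card_refl (h : IsHStrip a b) (h' : IsHStrip b c) :
    (refl a b c).card + b.card = a.card + c.card := by
  have hi := interlaces_reflRows h h'
  have key : ∀ n, rowsCard (refl a b c) (n + 1) + rowsCard b (n + 1) +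
      min (a.rowLen n) (c.rowLen (n + 1)) =
      rowsCard a (n + 1) + rowsCard c (n + 1) + c.rowLen (n + 1) := by
    rw [isHStrip_iff] at h h'
    intro n
    have h1 := h n
    have h2 := h' n
    induction n with
    | zero =>
      simp only [rowsCard_succ, rowsCard_zero, refl, hi.rowLen]
      simp only [reflRows, if_true]
      omega
    | succ n ih =>
      have := ih (h n) (h' n)
      have h3 := h n
      have h4 := h' n
      simp only [rowsCard_succ _ (n + 1)]
      have e : (refl a b c).rowLen (n + 1) = _ := hi.rowLen (n + 1)
      rw [e, reflRows, if_neg (Nat.succ_ne_zero n), Nat.add_sub_cancel]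
      omega
  let N := (refl a b c).colLen 0 + b.colLen 0 + a.colLen 0 + c.colLen 0
  have k := key N
  rw [rowsCard_of_colLen_le, rowsCard_of_colLen_le, rowsCard_of_colLen_le, rowsCard_of_colLen_le,
    rowLen_eq_zero_of_colLen_le (a := c)] at k
  · simpa using k
  all_goals omega

end refl

/-- The reverse reading word of the pair of horizontal strips `b / a`, `c / b` fails to be
lattice while reading row `p`. -/
def Violates (a b c : YoungDiagram) (p : ℕ) : Prop :=
  rowsCard b (p + 1) + rowsCard b p < rowsCard c (p + 1) + rowsCard a p

/-- The row lengths of the partial reflection of `b` between `a` and `c` from row `p` on. -/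
def flipRows (p : ℕ) (a b c : YoungDiagram) (s : ℕ) : ℕ :=
  if s < p then b.rowLen s
  else if s = p then max (a.rowLen p) (c.rowLen (p + 1)) +
    (rowsCard c (p + 1) + rowsCard a p - rowsCard b (p + 1) - rowsCard b p - 1)
  else reflRows a b c s

/-- The partial reflection of `b` between `a` and `c` from row `p` on. -/
def flip (p : ℕ) (a b c : YoungDiagram) : YoungDiagram := subRows c (flipRows p a b c)

section flip

variable {a b c : YoungDiagram} {p : ℕ}

theorem flipRows_of_lt {s : ℕ} (hs : p < s) : flipRows p a b c s = reflRows a b c s := by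
  rw [flipRows, if_neg (by omega), if_neg (by omega)]

theorem interlaces_flipRows (h : IsHStrip a b) (h' : IsHStrip b c) (hv : Violates a b c p)
    (hq : ∀ q < p, ¬ Violates a b c q) : Interlaces a c (flipRows p a b c) := by
  have hi := interlaces_reflRows h h'
  rw [isHStrip_iff] at h h'
  unfold Violates at hv hq
  have bound : max (a.rowLen p) (c.rowLen (p + 1)) ≤ flipRows p a b c p ∧
      flipRows p a b c p ≤ c.rowLen p ∧
      ∀ t, p = t + 1 → flipRows p a b c p ≤ a.rowLen t := by
    have e : flipRows p a b c p = _ := (if_neg (lt_irrefl p)).trans (if_pos rfl)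
    rw [e]
    have h1 := h p
    have h2 := h' p
    rcases p with _ | t
    · simp only [rowsCard_succ, rowsCard_zero] at hv ⊢
      exact ⟨by omega, by omega, fun t ht => by omega⟩
    · have h3 := hq t (Nat.lt_succ_self t)
      have h4 := h t
      have h5 := h' t
      simp only [rowsCard_succ] at hv h3 ⊢
      refine ⟨by omega, by omega, fun t' ht => ?_⟩
      obtain rfl : t = t' := by omega
      omega
  intro r
  have h1 := h r
  have h2 := h' r
  have hr := hi r
  rcases lt_trichotomy r p with hlt | rfl | hgt
  · have e1 : flipRows p a b c r = b.rowLen r := if_pos hlt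
    refine ⟨by omega, by omega, by omega, ?_⟩
    rcases lt_or_eq_of_le (Nat.succ_le_of_lt hlt) with hlt' | heq
    · have e2 : flipRows p a b c (r + 1) = b.rowLen (r + 1) := if_pos hlt'
      omega
    · have := bound.2.2 r heq.symm
      rwa [← heq] at this ⊢
  · have e2 : flipRows r a b c (r + 1) = reflRows a b c (r + 1) :=
      flipRows_of_lt (by omega)
    exact ⟨by omega, by omega, by omega, by omega⟩
  · have e1 : flipRows p a b c r = reflRows a b c r := flipRows_of_lt hgt
    have e2 : flipRows p a b c (r + 1) = reflRows a b c (r + 1) :=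
      flipRows_of_lt (by omega)
    rw [e1, e2]
    exact hr

theorem rowsCard_flip_of_le (hi : Interlaces a c (flipRows p a b c)) {q : ℕ} (hq : q ≤ p) :
    rowsCard (flip p a b c) q = rowsCard b q := by
  induction q with
  | zero => simp [rowsCard_zero]
  | succ q ih =>
    have e : (flip p a b c).rowLen q = _ := hi.rowLen q
    rw [rowsCard_succ, rowsCard_succ, ih (by omega), e, flipRows, if_pos (by omega)]

theorem rowLen_flip_self (hi : Interlaces a c (flipRows p a b c)) :
    (flip p a b c).rowLen p = max (a.rowLen p) (c.rowLen (p + 1)) +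
    (rowsCard c (p + 1) + rowsCard a p - rowsCard b (p + 1) - rowsCard b p - 1) := by
  rw [flip, hi.rowLen, flipRows, if_neg (lt_irrefl p), if_pos rfl]

theorem violates_flip (h : IsHStrip a b) (h' : IsHStrip b c) (hv : Violates a b c p)
    (hi : Interlaces a c (flipRows p a b c)) : Violates a (flip p a b c) c p := by
  have e := rowLen_flip_self hi
  rw [isHStrip_iff] at h h'
  have h1 := h p
  have h2 := h' p
  unfold Violates at hv ⊢
  have e' := rowsCard_flip_of_le hi le_rfl
  simp only [rowsCard_succ, e', e] at hv ⊢
  omega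

theorem flip_flip (h : IsHStrip a b) (h' : IsHStrip b c) (hv : Violates a b c p)
    (hi : Interlaces a c (flipRows p a b c))
    (hi' : Interlaces a c (flipRows p a (flip p a b c) c)) :
    flip p a (flip p a b c) c = b := by
  refine ext_rowLen fun r => ?_
  have hr : (flip p a b c).rowLen r = _ := hi.rowLen r
  rcases lt_trichotomy r p with hlt | rfl | hgt
  · rw [flip, hi'.rowLen, flipRows, if_pos hlt, hr, flipRows, if_pos hlt]
  · rw [rowLen_flip_self hi', rowsCard_succ (flip r a b c), rowsCard_flip_of_le hi le_rfl,
      rowLen_flip_self hi]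
    rw [isHStrip_iff] at h h'
    have h1 := h r
    have h2 := h' r
    unfold Violates at hv
    simp only [rowsCard_succ] at hv ⊢
    omega
  · obtain ⟨t, rfl⟩ : ∃ t, r = t + 1 := ⟨r - 1, by omega⟩
    rw [flip, hi'.rowLen, flipRows_of_lt hgt, reflRows, hr, flipRows_of_lt hgt, reflRows,
      if_neg (Nat.succ_ne_zero t), Nat.add_sub_cancel]
    rw [isHStrip_iff] at h h'
    have h1 := h (t + 1)
    have h2 := h' (t + 1)
    have h3 := h t
    have h4 := h' t
    omega

theorem card_flip (h : IsHStrip a b) (h' : IsHStrip b c) (hv : Violates a b c p)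
    (hi : Interlaces a c (flipRows p a b c)) :
    (flip p a b c).card + b.card + 1 = a.card + c.card := by
  have key : ∀ n ≥ p, rowsCard (flip p a b c) (n + 1) + rowsCard b (n + 1) + 1 +
      min (a.rowLen n) (c.rowLen (n + 1)) =
      rowsCard a (n + 1) + rowsCard c (n + 1) + c.rowLen (n + 1) := by
    rw [isHStrip_iff] at h h'
    intro n hn
    have h1 := h n
    have h2 := h' n
    induction n, hn using Nat.le_induction with
    | base =>
      rw [rowsCard_succ (flip p a b c), rowsCard_flip_of_le hi le_rfl, rowLen_flip_self hi]
      unfold Violates at hv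
      simp only [rowsCard_succ] at hv ⊢
      omega
    | succ n hn ih =>
      have := ih (h n) (h' n)
      have h3 := h n
      have h4 := h' n
      simp only [rowsCard_succ _ (n + 1)]
      have e : (flip p a b c).rowLen (n + 1) = _ := hi.rowLen (n + 1)
      rw [e, flipRows_of_lt (by omega), reflRows, if_neg (Nat.succ_ne_zero n), Nat.add_sub_cancel]
      omega
  let N := (flip p a b c).colLen 0 + b.colLen 0 + a.colLen 0 + c.colLen 0 + p
  have k := key N (by omega)
  rw [rowsCard_of_colLen_le, rowsCard_of_colLen_le, rowsCard_of_colLen_le, rowsCard_of_colLen_le,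
    rowLen_eq_zero_of_colLen_le (a := c)] at k
  · simpa using k
  all_goals omega

end flip

theorem Iic_finite (b : YoungDiagram) : (Set.Iic b).Finite := by
  refine Set.Finite.of_injOn (f := YoungDiagram.cells) (t := (b.cells.powerset : Set _)) ?_ ?_
    (Finset.finite_toSet _)
  · intro a ha
    exact Finset.mem_coe.2 (Finset.mem_powerset.2 (YoungDiagram.cells_subset_iff.2 ha))
  · intro a _ c _ h
    exact YoungDiagram.ext h

/-- Sequences of diagrams which grow from `a` to `b` by `n` horizontal strips. -/
def IsChain (n : ℕ) (a b : YoungDiagram) (C : ℕ → YoungDiagram) : Prop :=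
  C 0 = a ∧ (∀ i, n ≤ i → C i = b) ∧ ∀ i, IsHStrip (C i) (C (i + 1))

section IsChain

variable {n : ℕ} {a b : YoungDiagram} {C : ℕ → YoungDiagram}

theorem IsChain.monotone (h : IsChain n a b C) : Monotone C :=
  monotone_nat_of_le_succ fun i => (h.2.2 i).1

theorem IsChain.le (h : IsChain n a b C) (i : ℕ) : C i ≤ b :=
  (h.monotone (le_max_left i n)).trans (h.2.1 _ (le_max_right i n)).le

theorem isChain_finite (n : ℕ) (a b : YoungDiagram) : {C | IsChain n a b C}.Finite := by
  refine Set.Finite.of_injOn (f := fun C (i : Fin n) => C i)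
    (t := Set.univ.pi fun _ => Set.Iic b) ?_ ?_ (Set.Finite.pi fun _ => Iic_finite b)
  · intro C hC i _
    exact IsChain.le hC i
  · intro C hC D hD h
    funext i
    rcases lt_or_ge i n with hi | hi
    · exact congrFun h ⟨i, hi⟩
    · rw [And.left (And.right hC) i hi, And.left (And.right hD) i hi]

end IsChain

/-- The finite set of sequences of diagrams which grow from `a` to `b` by `n` horizontal
strips. -/
def chains (n : ℕ) (a b : YoungDiagram) : Finset (ℕ → YoungDiagram) :=
  (isChain_finite n a b).toFinset

theorem mem_chains {n : ℕ} {a b : YoungDiagram} {C : ℕ → YoungDiagram} :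
    C ∈ chains n a b ↔ IsChain n a b C := by
  simp [chains]

/-- The chain `C` violates the lattice condition for the letters `i + 1`, `i + 2` in row `p`. -/
def ViolatesAt (C : ℕ → YoungDiagram) (p i : ℕ) : Prop :=
  Violates (C i) (C (i + 1)) (C (i + 2)) p

/-- The chain `C` satisfies the lattice condition. -/
def IsLattice (C : ℕ → YoungDiagram) : Prop := ∀ p i, ¬ ViolatesAt C p i

/-- The first violation of the lattice condition, in the order of rows and then
of decreasing letters. -/
def IsFirst (C : ℕ → YoungDiagram) (p i : ℕ) : Prop :=
  ViolatesAt C p i ∧ (∀ q < p, ∀ j, ¬ ViolatesAt C q j) ∧ ∀ j > i, ¬ ViolatesAt C p j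

/-- The partial reflection of the chain `C` in letters `i + 1`, `i + 2` from row `p` on. -/
def flipChain (p i : ℕ) (C : ℕ → YoungDiagram) : ℕ → YoungDiagram :=
  Function.update C (i + 1) (flip p (C i) (C (i + 1)) (C (i + 2)))

theorem IsFirst.unique {C : ℕ → YoungDiagram} {p i q j : ℕ} (h : IsFirst C p i)
    (h' : IsFirst C q j) : p = q ∧ i = j := by
  obtain rfl : p = q := by
    rcases lt_trichotomy p q with hlt | heq | hlt
    · exact absurd h.1 (h'.2.1 p hlt i)
    · exact heq
    · exact absurd h'.1 (h.2.1 q hlt j)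
  refine ⟨rfl, ?_⟩
  rcases lt_trichotomy i j with hlt | heq | hlt
  · exact absurd h'.1 (h.2.2 j hlt)
  · exact heq
  · exact absurd h.1 (h'.2.2 i hlt)

section chain

variable {n : ℕ} {a b : YoungDiagram} {C : ℕ → YoungDiagram} {p i : ℕ}

theorem IsChain.lt_of_violatesAt (hC : IsChain n a b C) (h : ViolatesAt C p i) : i + 1 < n := by
  by_contra! hn
  unfold ViolatesAt Violates at h
  rw [hC.2.1 (i + 1) hn, hC.2.1 (i + 2) (by omega)] at h
  have := rowsCard_mono (hC.le i) p
  omega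

theorem IsChain.exists_isFirst (hC : IsChain n a b C) (h : ¬ IsLattice C) :
    ∃ p i, IsFirst C p i := by
  unfold IsLattice at h
  push Not at h
  let p := Nat.find h
  obtain ⟨i, hi⟩ : ∃ i, ViolatesAt C p i := Nat.find_spec h
  have hle : i ≤ n := by
    have := hC.lt_of_violatesAt hi
    omega
  refine ⟨p, Nat.findGreatest (ViolatesAt C p) n, Nat.findGreatest_spec hle hi, ?_, ?_⟩
  · intro q hq j hj
    exact Nat.find_min h hq ⟨j, hj⟩
  · intro j hj hv
    have := hC.lt_of_violatesAt hv
    exact Nat.findGreatest_is_greatest hj (by omega) hv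

theorem IsChain.interlaces (hC : IsChain n a b C) (h : IsFirst C p i) :
    Interlaces (C i) (C (i + 2)) (flipRows p (C i) (C (i + 1)) (C (i + 2))) :=
  interlaces_flipRows (hC.2.2 i) (hC.2.2 (i + 1)) h.1 fun q hq => h.2.1 q hq i

theorem flipChain_self : flipChain p i C (i + 1) = flip p (C i) (C (i + 1)) (C (i + 2)) :=
  Function.update_self _ _ _

theorem flipChain_of_ne {j : ℕ} (hj : j ≠ i + 1) : flipChain p i C j = C j :=
  Function.update_of_ne hj _ _

theorem IsChain.flipChain (hC : IsChain n a b C) (h : IsFirst C p i) :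
    IsChain n a b (flipChain p i C) := by
  have hn := hC.lt_of_violatesAt h.1
  have hI := hC.interlaces h
  refine ⟨?_, fun j hj => ?_, fun j => ?_⟩
  · rw [flipChain_of_ne (by omega), hC.1]
  · rw [flipChain_of_ne (by omega), hC.2.1 j hj]
  · rcases eq_or_ne j i with rfl | hj
    · rw [flipChain_self, flipChain_of_ne (by omega)]
      exact hI.left
    rcases eq_or_ne j (i + 1) with rfl | hj'
    · rw [flipChain_self, flipChain_of_ne (by omega)]
      exact hI.right
    · rw [flipChain_of_ne hj', flipChain_of_ne (by omega)]
      exact hC.2.2 j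

theorem IsChain.rowsCard_flipChain (hC : IsChain n a b C) (h : IsFirst C p i) (j : ℕ) {q : ℕ}
    (hq : q ≤ p) : rowsCard (ChernTensor.flipChain p i C j) q = rowsCard (C j) q := by
  rcases eq_or_ne j (i + 1) with rfl | hj
  · rw [flipChain_self, rowsCard_flip_of_le (hC.interlaces h) hq]
  · rw [flipChain_of_ne hj]

theorem IsChain.isFirst_flipChain (hC : IsChain n a b C) (h : IsFirst C p i) :
    IsFirst (ChernTensor.flipChain p i C) p i := by
  refine ⟨?_, fun q hq j hj => h.2.1 q hq j ?_, fun j hj hv => h.2.2 j hj ?_⟩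
  · unfold ViolatesAt
    rw [flipChain_self, flipChain_of_ne (by omega), flipChain_of_ne (by omega)]
    exact violates_flip (hC.2.2 i) (hC.2.2 (i + 1)) h.1 (hC.interlaces h)
  · unfold ViolatesAt Violates at hj ⊢
    simpa only [hC.rowsCard_flipChain h _ hq.le, hC.rowsCard_flipChain h _ (Nat.succ_le_of_lt hq)]
      using hj
  · unfold ViolatesAt Violates at hv ⊢
    rw [hC.rowsCard_flipChain h _ le_rfl, hC.rowsCard_flipChain h _ le_rfl,
      flipChain_of_ne (by omega), flipChain_of_ne (by omega)] at hv
    exact hv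

theorem IsChain.flipChain_flipChain (hC : IsChain n a b C) (h : IsFirst C p i) :
    ChernTensor.flipChain p i (ChernTensor.flipChain p i C) = C := by
  funext j
  rcases eq_or_ne j (i + 1) with rfl | hj
  · have hI := (hC.flipChain h).interlaces (hC.isFirst_flipChain h)
    rw [flipChain_self, flipChain_of_ne (by omega), flipChain_of_ne (by omega)] at hI
    rw [flipChain_self, flipChain_self, flipChain_of_ne (by omega), flipChain_of_ne (by omega)]
    exact flip_flip (hC.2.2 i) (hC.2.2 (i + 1)) h.1 (hC.interlaces h) hI
  · rw [flipChain_of_ne hj, flipChain_of_ne hj]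

theorem IsChain.card_flipChain (hC : IsChain n a b C) (h : IsFirst C p i) :
    (ChernTensor.flipChain p i C (i + 1)).card + (C (i + 1)).card + 1 =
      (C i).card + (C (i + 2)).card := by
  rw [flipChain_self]
  exact card_flip (hC.2.2 i) (hC.2.2 (i + 1)) h.1 (hC.interlaces h)

end chain

/-- The `j`-th strip of `C` has size `j + w (s j)`. -/
def HasShiftedContent {n : ℕ} (w : ℕ → ℤ) (C : ℕ → YoungDiagram) (s : Equiv.Perm (Fin n)) : Prop :=
  ∀ j : Fin n, ((C (j + 1)).card : ℤ) = (C j).card + j + w (s j)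

/-- The transposition of `i` and `i + 1` in `Fin n`. -/
def adjSwap (n i : ℕ) : Equiv.Perm (Fin n) :=
  if h : i + 1 < n then Equiv.swap ⟨i, by omega⟩ ⟨i + 1, h⟩ else 1

/-- Partial reflection at the first violation of the lattice condition. -/
def toggle {n : ℕ} (x : Equiv.Perm (Fin n) × (ℕ → YoungDiagram)) :
    Equiv.Perm (Fin n) × (ℕ → YoungDiagram) :=
  if h : ∃ q : ℕ × ℕ, IsFirst x.2 q.1 q.2 then
    (x.1 * adjSwap n h.choose.2, flipChain h.choose.1 h.choose.2 x.2) else x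

theorem toggle_eq {n : ℕ} {x : Equiv.Perm (Fin n) × (ℕ → YoungDiagram)} {p i : ℕ}
    (h : IsFirst x.2 p i) : toggle x = (x.1 * adjSwap n i, flipChain p i x.2) := by
  have hex : ∃ q : ℕ × ℕ, IsFirst x.2 q.1 q.2 := ⟨(p, i), h⟩
  obtain ⟨h1, h2⟩ := hex.choose_spec.unique h
  rw [toggle, dif_pos hex, h1, h2]

section sign

variable {n : ℕ} {a b : YoungDiagram} {C : ℕ → YoungDiagram} {w : ℕ → ℤ}
  {s : Equiv.Perm (Fin n)}

theorem HasShiftedContent.flip (hw : HasShiftedContent w C s) (hC : IsChain n a b C) {p i : ℕ}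
    (h : IsFirst C p i) : HasShiftedContent w (flipChain p i C) (s * adjSwap n i) := by
  have hn := hC.lt_of_violatesAt h.1
  have hcard := hC.card_flipChain h
  have h1 := hw ⟨i, by omega⟩
  have h2 := hw ⟨i + 1, hn⟩
  rintro ⟨j, hj⟩
  rw [adjSwap, dif_pos hn, Equiv.Perm.mul_apply]
  simp only [Nat.cast_add, Nat.cast_one] at h1 h2 ⊢
  rcases eq_or_ne j i with rfl | hj1
  · rw [Equiv.swap_apply_left, flipChain_of_ne (j := j) (by omega)]
    have : j + 1 + 1 = j + 2 := rfl
    rw [this] at h2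
    omega
  rcases eq_or_ne j (i + 1) with rfl | hj2
  · rw [Equiv.swap_apply_right, flipChain_of_ne (j := i + 1 + 1) (by omega)]
    have : i + 1 + 1 = i + 2 := rfl
    rw [this] at h2 ⊢
    push_cast at h1 h2 ⊢
    omega
  · rw [Equiv.swap_apply_of_ne_of_ne (by simpa using hj1) (by simpa using hj2),
      flipChain_of_ne hj2, flipChain_of_ne (by omega)]
    exact hw ⟨j, hj⟩

theorem IsLattice.card_le (hL : IsLattice C) (i : ℕ) :
    (C (i + 2)).card + (C i).card ≤ (C (i + 1)).card + (C (i + 1)).card := by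
  have h := hL ((C i).colLen 0 + (C (i + 1)).colLen 0 + (C (i + 2)).colLen 0) i
  unfold ViolatesAt Violates at h
  rwa [rowsCard_of_colLen_le (by omega), rowsCard_of_colLen_le (by omega),
    rowsCard_of_colLen_le (by omega), rowsCard_of_colLen_le (by omega), not_lt] at h

theorem HasShiftedContent.eq_one (hw : HasShiftedContent w C s) (hL : IsLattice C)
    (ha : StrictAnti w) : s = 1 := by
  have hs : StrictMono s := by
    rcases n with _ | n
    · exact fun i => i.elim0
    rw [Fin.strictMono_iff_lt_succ]
    intro i
    have h1 := hw i.castSucc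
    have h2 := hw i.succ
    have h3 := IsLattice.card_le hL i
    simp only [Fin.val_castSucc, Fin.val_succ] at h1 h2
    push_cast at h2
    have h4 : w (s i.succ) < w (s i.castSucc) := by
      have : (i : ℕ) + 1 + 1 = i + 2 := rfl
      rw [this] at h2
      omega
    exact ha.lt_iff_gt.1 h4
  have := Subsingleton.elim (hs.orderIsoOfSurjective s s.surjective) (OrderIso.refl _)
  ext i
  exact congrArg (fun g : Fin n ≃o Fin n => ((g i : Fin n) : ℕ)) this

theorem sum_sign_card_chains (n : ℕ) (a b : YoungDiagram) (ha : StrictAnti w) :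
    ∑ s : Equiv.Perm (Fin n), (Equiv.Perm.sign s : ℤ) *
      ((chains n a b).filter (fun C => HasShiftedContent w C s)).card =
    ((chains n a b).filter
      (fun C => IsLattice C ∧ HasShiftedContent w C (1 : Equiv.Perm (Fin n)))).card := by
  let S := ((Finset.univ : Finset (Equiv.Perm (Fin n))) ×ˢ chains n a b).filter
    fun x => HasShiftedContent w x.2 x.1
  have hS : ∀ x, x ∈ S ↔ IsChain n a b x.2 ∧ HasShiftedContent w x.2 x.1 := by
    intro x
    simp [S, mem_chains]
  have e1 : ∑ s : Equiv.Perm (Fin n), (Equiv.Perm.sign s : ℤ) *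
      ((chains n a b).filter (fun C => HasShiftedContent w C s)).card =
      ∑ x ∈ S, (Equiv.Perm.sign x.1 : ℤ) := by
    rw [Finset.sum_filter, Finset.sum_product]
    refine Finset.sum_congr rfl fun s _ => ?_
    rw [← Finset.sum_filter]
    simp only [Finset.sum_const, nsmul_eq_mul]
    rw [mul_comm]
  rw [e1, ← Finset.sum_filter_add_sum_filter_not S (fun x => IsLattice x.2)]
  have e2 : ∑ x ∈ S.filter (fun x => ¬ IsLattice x.2), (Equiv.Perm.sign x.1 : ℤ) = 0 := by
    have key : ∀ x ∈ S.filter (fun x => ¬ IsLattice x.2), ∃ p i, IsFirst x.2 p i ∧ i + 1 < n ∧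
        toggle x = (x.1 * adjSwap n i, flipChain p i x.2) := by
      intro x hx
      rw [Finset.mem_filter, hS] at hx
      obtain ⟨p, i, h⟩ := hx.1.1.exists_isFirst hx.2
      exact ⟨p, i, h, hx.1.1.lt_of_violatesAt h.1, toggle_eq h⟩
    have hsign : ∀ i, i + 1 < n → Equiv.Perm.sign (adjSwap n i) = -1 := by
      intro i hi
      rw [adjSwap, dif_pos hi, Equiv.Perm.sign_swap]
      simp
    refine Finset.sum_involution (fun x _ => toggle x) ?_ ?_ ?_ ?_
    · intro x hx
      obtain ⟨p, i, h, hi, e⟩ := key x hx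
      rw [e]
      simp [hsign i hi]
    · intro x hx _ heq
      obtain ⟨p, i, h, hi, e⟩ := key x hx
      rw [e] at heq
      have h3 := congrArg (fun y => Equiv.Perm.sign y.1) heq
      simp only [map_mul, hsign i hi] at h3
      rcases Int.units_eq_one_or (Equiv.Perm.sign x.1) with h4 | h4 <;> rw [h4] at h3 <;>
        exact absurd h3 (by decide)
    · intro x hx
      obtain ⟨p, i, h, hi, e⟩ := key x hx
      rw [Finset.mem_filter, hS] at hx ⊢
      rw [e]
      exact ⟨⟨hx.1.1.flipChain h, hx.1.2.flip hx.1.1 h⟩,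
        fun hL => hL p i (hx.1.1.isFirst_flipChain h).1⟩
    · intro x hx
      obtain ⟨p, i, h, hi, e⟩ := key x hx
      rw [Finset.mem_filter, hS] at hx
      simp only [e]
      rw [toggle_eq (hx.1.1.isFirst_flipChain h)]
      simp only
      rw [hx.1.1.flipChain_flipChain h, mul_assoc, adjSwap, dif_pos hi, Equiv.swap_mul_self,
        mul_one]
  rw [e2, add_zero]
  have e3 : S.filter (fun x => IsLattice x.2) =
      ((chains n a b).filter (fun C => IsLattice C ∧
        HasShiftedContent w C (1 : Equiv.Perm (Fin n)))).image
        fun C => (1, C) := by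
    ext ⟨s, C⟩
    simp only [Finset.mem_filter, hS, Finset.mem_image, mem_chains, Prod.mk.injEq]
    constructor
    · rintro ⟨⟨hC, hw⟩, hL⟩
      obtain rfl := hw.eq_one hL ha
      exact ⟨C, ⟨hC, hL, hw⟩, rfl, rfl⟩
    · rintro ⟨D, ⟨hC, hL, hw⟩, rfl, rfl⟩
      exact ⟨⟨hC, hw⟩, hL⟩
  rw [e3, Finset.sum_image fun _ _ _ _ h => (Prod.mk.inj h).2]
  simp

end sign

instance : LocallyFiniteOrder YoungDiagram :=
  LocallyFiniteOrder.ofFiniteIcc fun _ b => (Iic_finite b).subset Set.Icc_subset_Iic_self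

/-- The incidence algebra of Young's lattice. -/
abbrev YoungAlgebra : Type := IncidenceAlgebra ℤ YoungDiagram

/-- The transfer matrix of horizontal strips of size `k`. -/
def stripOp (k : ℤ) : YoungAlgebra :=
  ⟨fun a b => if IsHStrip a b ∧ (b.card : ℤ) = a.card + k then 1 else 0,
    fun _ _ h => if_neg fun h' => h h'.1.1⟩

theorem stripOp_apply (k : ℤ) (a b : YoungDiagram) :
    stripOp k a b = if IsHStrip a b ∧ (b.card : ℤ) = a.card + k then 1 else 0 := rfl

theorem stripOp_mul_stripOp_apply (k l : ℤ) (a c : YoungDiagram) :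
    (stripOp k * stripOp l) a c = ((Finset.Icc a c).filter fun b =>
      (IsHStrip a b ∧ (b.card : ℤ) = a.card + k) ∧
        IsHStrip b c ∧ (c.card : ℤ) = b.card + l).card := by
  rw [IncidenceAlgebra.mul_apply, Finset.card_filter]
  push_cast
  refine Finset.sum_congr rfl fun b _ => ?_
  rw [stripOp_apply, stripOp_apply, ite_zero_mul_ite_zero, one_mul]

theorem stripOp_comm (k l : ℤ) : stripOp k * stripOp l = stripOp l * stripOp k := by
  ext a c _
  rw [stripOp_mul_stripOp_apply, stripOp_mul_stripOp_apply, Nat.cast_inj]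
  have key : ∀ {k l : ℤ} {b : YoungDiagram}, b ∈ ((Finset.Icc a c).filter fun b =>
      (IsHStrip a b ∧ (b.card : ℤ) = a.card + k) ∧
        IsHStrip b c ∧ (c.card : ℤ) = b.card + l) →
      refl a b c ∈ ((Finset.Icc a c).filter fun b =>
      (IsHStrip a b ∧ (b.card : ℤ) = a.card + l) ∧
        IsHStrip b c ∧ (c.card : ℤ) = b.card + k) := by
    intro k l b hb
    simp only [Finset.mem_filter, Finset.mem_Icc] at hb ⊢
    obtain ⟨-, ⟨h, h1⟩, h', h2⟩ := hb
    have hi := interlaces_reflRows h h'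
    have hc := card_refl h h'
    exact ⟨⟨hi.left.1, hi.right.1⟩, ⟨hi.left, by omega⟩, hi.right, by omega⟩
  refine Finset.card_nbij' (fun b => refl a b c) (fun b => refl a b c)
    (fun b hb => key hb) (fun b hb => key hb) (fun b hb => ?_) fun b hb => ?_ <;>
  · simp only [Finset.coe_filter, Set.mem_ofPred_eq] at hb
    exact refl_refl hb.2.1.1 hb.2.2.1

/-- The product of the transfer matrices of horizontal strips of sizes `c 0`, …, `c (n - 1)`. -/
def stripProd (c : ℕ → ℤ) : ℕ → YoungAlgebra
  | 0 => 1
  | n + 1 => stripProd c n * stripOp (c n)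

theorem stripProd_apply (c : ℕ → ℤ) (n : ℕ) (a b : YoungDiagram) :
    stripProd c n a b = ((chains n a b).filter fun C =>
      ∀ j < n, ((C (j + 1)).card : ℤ) = (C j).card + c j).card := by
  induction n generalizing b with
  | zero =>
    rw [stripProd, IncidenceAlgebra.one_apply]
    split_ifs with h
    · subst h
      symm
      rw [Nat.cast_eq_one, Finset.card_eq_one]
      refine ⟨fun _ => a, Finset.ext fun C => ?_⟩
      simp only [Finset.mem_filter, mem_chains, Finset.mem_singleton]
      constructor
      · rintro ⟨hC, -⟩
        exact funext fun i => hC.2.1 i (Nat.zero_le i)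
      · rintro rfl
        exact ⟨⟨rfl, fun _ _ => rfl, fun _ => IsHStrip.refl a⟩, fun j hj => absurd hj (by omega)⟩
    · symm
      rw [Nat.cast_eq_zero, Finset.card_eq_zero, Finset.eq_empty_iff_forall_notMem]
      intro C hC
      simp only [Finset.mem_filter, mem_chains] at hC
      exact h (hC.1.1.symm.trans (hC.1.2.1 0 le_rfl))
  | succ n ih =>
    rw [stripProd, IncidenceAlgebra.mul_apply,
      Finset.card_eq_sum_card_fiberwise (f := fun C => C n) (t := Finset.Icc a b)]
    · push_cast
      refine Finset.sum_congr rfl fun x hx => ?_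
      rw [ih, stripOp_apply]
      split_ifs with hs
      · rw [mul_one, Nat.cast_inj]
        refine Finset.card_nbij' (fun C i => if i ≤ n then C i else b) (fun C i => C (min i n))
          ?_ ?_ ?_ ?_
        · intro C hC
          simp only [Finset.coe_filter, Set.mem_ofPred_eq, mem_chains, Finset.mem_filter] at hC ⊢
          obtain ⟨hC, hc⟩ := hC
          have hx := hC.2.1 n le_rfl
          refine ⟨⟨⟨by simpa using hC.1, fun i hi => if_neg (by omega), fun i => ?_⟩,
            fun j hj => ?_⟩, by simpa using hx⟩ <;> beta_reduce
          · rcases lt_trichotomy i n with h | rfl | h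
            · rw [if_pos h.le, if_pos (by omega)]
              exact hC.2.2 i
            · rw [if_pos le_rfl, if_neg (by omega), hx]
              exact hs.1
            · rw [if_neg (by omega), if_neg (by omega)]
              exact IsHStrip.refl b
          · rcases (Nat.lt_succ_iff.1 hj).lt_or_eq with h | rfl
            · rw [if_pos h.le, if_pos (by omega)]
              exact hc j h
            · rw [if_pos le_rfl, if_neg (by omega), hx]
              exact hs.2
        · intro C hC
          simp only [Finset.coe_filter, Set.mem_ofPred_eq, mem_chains, Finset.mem_filter] at hC ⊢
          obtain ⟨⟨hC, hc⟩, hx⟩ := hC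
          refine ⟨⟨by simpa using hC.1, fun i hi => by beta_reduce; rw [min_eq_right hi, hx],
            fun i => ?_⟩, fun j hj => ?_⟩ <;> beta_reduce
          · rcases lt_or_ge i n with h | h
            · rw [min_eq_left h.le, min_eq_left (by omega)]
              exact hC.2.2 i
            · rw [min_eq_right h, min_eq_right (by omega)]
              exact IsHStrip.refl _
          · rw [min_eq_left hj.le, min_eq_left (by omega)]
            exact hc j (by omega)
        · intro C hC
          simp only [Finset.coe_filter, Set.mem_ofPred_eq, mem_chains] at hC
          funext i
          simp only [min_le_right, if_true]
          rcases le_total i n with h | h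
          · rw [min_eq_left h]
          · rw [min_eq_right h, hC.1.2.1 n le_rfl, hC.1.2.1 i h]
        · intro C hC
          simp only [Finset.coe_filter, Set.mem_ofPred_eq, mem_chains, Finset.mem_filter] at hC
          funext i
          simp only
          split_ifs with h
          · rw [min_eq_left h]
          · exact (hC.1.1.2.1 i (by omega)).symm
      · symm
        rw [mul_zero, Nat.cast_eq_zero, Finset.card_eq_zero, Finset.eq_empty_iff_forall_notMem]
        intro C hC
        simp only [Finset.mem_filter, mem_chains] at hC
        obtain ⟨⟨hC, hc⟩, rfl⟩ := hC
        refine hs ⟨?_, ?_⟩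
        · rw [← hC.2.1 (n + 1) le_rfl]
          exact hC.2.2 n
        · rw [← hC.2.1 (n + 1) le_rfl]
          exact hc n (Nat.lt_succ_self n)
    · intro C hC
      simp only [Finset.coe_filter, Set.mem_ofPred_eq, mem_chains] at hC
      rw [Finset.mem_coe, Finset.mem_Icc]
      exact ⟨hC.1.1.ge.trans (hC.1.monotone (Nat.zero_le n)), hC.1.le n⟩

/-- The subring generated by the transfer matrices of horizontal strips. -/
def stripRing : Subring YoungAlgebra := Subring.closure (Set.range stripOp)

theorem stripOp_mem (k : ℤ) : stripOp k ∈ stripRing :=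
  Subring.subset_closure ⟨k, rfl⟩

theorem stripRing_comm {x y : YoungAlgebra} (hx : x ∈ stripRing) (hy : y ∈ stripRing) :
    x * y = y * x := by
  have := Subring.closure_induction₂ (p := fun x y _ _ => Commute x y) (s := Set.range stripOp)
    (by
      rintro _ _ ⟨k, rfl⟩ ⟨l, rfl⟩
      exact stripOp_comm k l)
    (fun x _ => Commute.zero_left x) (fun x _ => Commute.zero_right x)
    (fun x _ => Commute.one_left x) (fun x _ => Commute.one_right x)
    (fun _ _ _ _ h => h.neg_left) (fun _ _ _ _ h => h.neg_right)
    (fun _ _ _ _ _ _ h h' => h.add_left h') (fun _ _ _ _ _ _ h h' => h.add_right h')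
    (fun _ _ _ _ _ _ h h' => h.mul_left h') (fun _ _ _ _ _ _ h h' => h.mul_right h') hx hy
  exact this

theorem stripProd_mem (c : ℕ → ℤ) (n : ℕ) : stripProd c n ∈ stripRing := by
  induction n with
  | zero => exact one_mem _
  | succ n ih => exact mul_mem ih (stripOp_mem _)

/-- Evaluation of an element of the incidence algebra. -/
def evalHom (a b : YoungDiagram) : YoungAlgebra →+ ℤ where
  toFun x := x a b
  map_zero' := rfl
  map_add' _ _ := rfl

/-- There is an element of `stripRing` which counts the lattice chains of content `j + w j`. -/
theorem exists_mem_stripRing (n : ℕ) {w : ℕ → ℤ} (hw : StrictAnti w) :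
    ∃ x ∈ stripRing, ∀ a b, x a b = ((chains n a b).filter
      (fun C => IsLattice C ∧ HasShiftedContent w C (1 : Equiv.Perm (Fin n)))).card := by
  let c (s : Equiv.Perm (Fin n)) (j : ℕ) : ℤ := if h : j < n then j + w (s ⟨j, h⟩) else 0
  refine ⟨∑ s : Equiv.Perm (Fin n), (Equiv.Perm.sign s : ℤ) • stripProd (c s) n,
    sum_mem fun s _ => zsmul_mem (stripProd_mem _ _) _, fun a b => ?_⟩
  rw [← sum_sign_card_chains n a b hw]
  change evalHom a b _ = _
  rw [map_sum]
  refine Finset.sum_congr rfl fun s _ => ?_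
  rw [map_zsmul, smul_eq_mul]
  congr 1
  change stripProd (c s) n a b = _
  rw [stripProd_apply]
  congr 2
  refine Finset.filter_congr fun C _ => ?_
  constructor
  · rintro h ⟨j, hj⟩
    rw [h j hj]
    simp only [c, dif_pos hj]
    ring
  · intro h j hj
    rw [h ⟨j, hj⟩]
    simp only [c, dif_pos hj]
    ring

/-- `C i` consists of the cells of `ν` whose entry in the filling `T` is at most `i`. -/
structure IsLevels (nu : YoungDiagram) (T : ℕ × ℕ → ℕ) (C : ℕ → YoungDiagram) : Prop where
  mem_iff : ∀ i c, c ∈ C i ↔ c ∈ nu ∧ T c ≤ i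
  eq_zero : ∀ c, c ∉ nu → T c = 0

/-- The number of entries `k + 1` of `T` in the first `p` rows. -/
def entriesCard (lam nu : YoungDiagram) (T : ℕ × ℕ → ℕ) (k p : ℕ) : ℕ :=
  ((nu.cells \ lam.cells).filter (fun d => d.1 < p ∧ T d = k + 1)).card

/-- The diagram of the cells of `ν` with entries at most `i` weakly above and to the left. -/
def level (nu : YoungDiagram) (T : ℕ × ℕ → ℕ) (i : ℕ) : YoungDiagram :=
  ⟨nu.cells.filter fun c => ∀ d ≤ c, T d ≤ i, by
    intro c d hle hc
    simp only [Finset.coe_filter, Set.mem_ofPred_eq, YoungDiagram.mem_cells] at hc ⊢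
    exact ⟨nu.isLowerSet hle hc.1, fun e he => hc.2 e (he.trans hle)⟩⟩

theorem mem_level {nu : YoungDiagram} {T : ℕ × ℕ → ℕ} {i : ℕ} {c : ℕ × ℕ} :
    c ∈ level nu T i ↔ c ∈ nu ∧ ∀ d ≤ c, T d ≤ i := by
  rw [← YoungDiagram.mem_cells]
  simp [level]

theorem IsLRTableau.le_of_le {lam mu nu : YoungDiagram} {T : ℕ × ℕ → ℕ}
    (h : IsLRTableau lam mu nu T) {c d : ℕ × ℕ} (hc : c ∈ nu) (hd : d ≤ c) : T d ≤ T c := by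
  rcases Nat.eq_zero_or_pos (T d) with h0 | h0
  · exact h0.le.trans (Nat.zero_le _)
  obtain ⟨h1, h2, h3, -⟩ := h
  have hmem : d ∈ nu.cells \ lam.cells := (h1 d).2 h0.ne'
  have hup : ∀ e, d ≤ e → e ≤ c → e ∈ nu.cells \ lam.cells := by
    intro e hde hec
    simp only [Finset.mem_sdiff, YoungDiagram.mem_cells] at hmem ⊢
    exact ⟨nu.isLowerSet hec hc, fun he => hmem.2 (lam.isLowerSet hde he)⟩
  have hmid := hup (d.1, c.2) ⟨le_rfl, hd.2⟩ ⟨hd.1, le_rfl⟩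
  refine (h2 d.1 d.2 c.2 hd.2 hmem hmid).trans ?_
  rcases hd.1.lt_or_eq with hlt | heq
  · exact (h3 d.1 c.1 c.2 hlt hmid (hup c hd le_rfl)).le
  · rw [heq]

theorem IsLRTableau.isLevels {lam mu nu : YoungDiagram} {T : ℕ × ℕ → ℕ}
    (h : IsLRTableau lam mu nu T) : IsLevels nu T (level nu T) where
  mem_iff i c := by
    rw [mem_level]
    exact and_congr_right fun hc => ⟨fun h' => h' c le_rfl,
      fun h' d hd => (h.le_of_le hc hd).trans h'⟩
  eq_zero c hc := by
    by_contra h0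
    have := (h.1 c).2 h0
    simp only [Finset.mem_sdiff, YoungDiagram.mem_cells] at this
    exact hc this.1

namespace IsLevels

variable {mu nu : YoungDiagram} {T : ℕ × ℕ → ℕ} {C : ℕ → YoungDiagram} {n : ℕ}

theorem mem_skew (h : IsLevels nu T C) {c : ℕ × ℕ} :
    c ∈ nu.cells \ (C 0).cells ↔ T c ≠ 0 := by
  simp only [Finset.mem_sdiff, YoungDiagram.mem_cells, h.mem_iff]
  constructor
  · rintro ⟨h1, h2⟩ h0
    exact h2 ⟨h1, h0.le⟩
  · intro h0
    exact ⟨by_contra fun hc => h0 (h.eq_zero c hc), fun h2 => h0 (Nat.le_zero.1 h2.2)⟩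

theorem mem_of_ne_zero (h : IsLevels nu T C) {c : ℕ × ℕ} (hc : T c ≠ 0) : c ∈ nu := by
  by_contra hc'
  exact hc (h.eq_zero c hc')

theorem mono (h : IsLevels nu T C) : Monotone C := by
  intro i j hij c hc
  exact (h.mem_iff j c).2 ⟨((h.mem_iff i c).1 hc).1, ((h.mem_iff i c).1 hc).2.trans hij⟩

theorem entriesCard_add (h : IsLevels nu T C) (k p : ℕ) :
    entriesCard (C 0) nu T k p + rowsCard (C k) p = rowsCard (C (k + 1)) p := by
  unfold entriesCard rowsCard
  rw [← Finset.card_union_of_disjoint]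
  · congr 1
    ext c
    simp only [Finset.mem_union, Finset.mem_filter, h.mem_skew, YoungDiagram.mem_cells, h.mem_iff]
    constructor
    · rintro (⟨h1, h2, h3⟩ | ⟨⟨h1, h2⟩, h3⟩)
      · exact ⟨⟨h.mem_of_ne_zero h1, h3.le⟩, h2⟩
      · exact ⟨⟨h1, by omega⟩, h3⟩
    · rintro ⟨⟨h1, h2⟩, h3⟩
      rcases Nat.lt_or_ge k (T c) with h4 | h4
      · exact Or.inl ⟨by omega, h3, by omega⟩
      · exact Or.inr ⟨⟨h1, h4⟩, h3⟩
  · rw [Finset.disjoint_left]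
    intro c hc hc'
    simp only [Finset.mem_filter, YoungDiagram.mem_cells, h.mem_iff] at hc hc'
    omega

theorem card_filter_add (h : IsLevels nu T C) (k : ℕ) :
    ((nu.cells \ (C 0).cells).filter (fun c => T c = k + 1)).card + (C k).card =
      (C (k + 1)).card := by
  have hle : ∀ i c, c ∈ C i → c.1 < nu.colLen 0 := fun i c hc => by
    have := nu.up_left_mem (i1 := c.1) le_rfl (Nat.zero_le c.2) ((h.mem_iff i c).1 hc).1
    exact YoungDiagram.mem_iff_lt_colLen.1 this
  have h1 : ∀ i, rowsCard (C i) (nu.colLen 0) = (C i).card := fun i => by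
    rw [rowsCard, Finset.filter_true_of_mem fun c hc => hle i c hc]
  rw [← h1, ← h1, ← h.entriesCard_add, entriesCard]
  congr 2
  refine Finset.filter_congr fun c hc => ?_
  have hc' := h.mem_of_ne_zero (h.mem_skew.1 hc)
  have := YoungDiagram.mem_iff_lt_colLen.1 (nu.up_left_mem (i1 := c.1) le_rfl (Nat.zero_le c.2) hc')
  tauto

theorem violatesAt_iff (h : IsLevels nu T C) (p i : ℕ) :
    ViolatesAt C p i ↔ entriesCard (C 0) nu T i p < entriesCard (C 0) nu T (i + 1) (p + 1) := by
  have h1 := h.entriesCard_add i p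
  have h2 := h.entriesCard_add (i + 1) (p + 1)
  unfold ViolatesAt Violates
  have : i + 1 + 1 = i + 2 := rfl
  rw [this] at h2
  omega

theorem rows_le (h : IsLevels nu T C) {i j j' : ℕ} (hj : j ≤ j') (hc : T (i, j') ≠ 0) :
    T (i, j) ≤ T (i, j') := by
  have h1 : (i, j') ∈ C (T (i, j')) := (h.mem_iff _ _).2 ⟨h.mem_of_ne_zero hc, le_rfl⟩
  exact ((h.mem_iff _ _).1 ((C _).up_left_mem le_rfl hj h1)).2

theorem isLRTableau (h : IsLevels nu T C) (hC : IsChain n (C 0) nu C) (hL : IsLattice C)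
    (hmu : mu.colLen 0 ≤ n)
    (hcard : ∀ k < n, (C (k + 1)).card = (C k).card + mu.rowLen k) :
    IsLRTableau (C 0) mu nu T := by
  refine ⟨fun c => h.mem_skew, ?_, ?_, ?_, ?_⟩
  · intro i j j' hj _ hc
    exact h.rows_le hj (h.mem_skew.1 hc)
  · intro i i' j hi hc hc'
    obtain ⟨t, ht⟩ := Nat.exists_eq_succ_of_ne_zero (h.mem_skew.1 hc')
    obtain ⟨r, rfl⟩ : ∃ r, i' = r + 1 := ⟨i' - 1, by omega⟩
    have h1 : (r + 1, j) ∈ C (t + 1) := (h.mem_iff _ _).2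
      ⟨h.mem_of_ne_zero (h.mem_skew.1 hc'), ht.le⟩
    have h2 := (C t).up_left_mem (Nat.lt_succ_iff.1 hi) le_rfl ((hC.2.2 t).2 r j h1)
    have h3 := ((h.mem_iff _ _).1 h2).2
    omega
  · intro k
    have h1 := h.card_filter_add k
    rcases lt_or_ge k n with hk | hk
    · have := hcard k hk
      omega
    · rw [hC.2.1 k hk, hC.2.1 (k + 1) (by omega)] at h1
      rw [rowLen_eq_zero_of_colLen_le (hmu.trans hk)]
      omega
  · intro c _ k
    have h1 := hL c.1 k
    rw [h.violatesAt_iff, not_lt] at h1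
    refine le_trans (Finset.card_le_card ?_) (h1.trans (Finset.card_le_card ?_))
    · intro d hd
      simp only [Finset.mem_filter] at hd ⊢
      exact ⟨hd.1, by omega, hd.2.2⟩
    · intro d hd
      simp only [Finset.mem_filter] at hd ⊢
      exact ⟨hd.1, Or.inl hd.2.1, hd.2.2⟩

theorem isLattice (h : IsLevels nu T C) (hT : IsLRTableau (C 0) mu nu T) : IsLattice C := by
  intro p k
  rw [h.violatesAt_iff, not_lt]
  have hrow : ∀ q, entriesCard (C 0) nu T (k + 1) (q + 1) ≤ entriesCard (C 0) nu T (k + 1) q ∨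
      entriesCard (C 0) nu T (k + 1) (q + 1) ≤ entriesCard (C 0) nu T k q := by
    intro q
    by_cases hex : ∃ j, T (q, j) = k + 2
    · right
      have hj := Nat.find_spec hex
      have h1 := hT.2.2.2.2 (q, Nat.find hex) (h.mem_skew.2 (by omega)) k
      refine le_trans (Finset.card_le_card ?_) (h1.trans (Finset.card_le_card ?_))
      · rintro ⟨r, j⟩ hd
        simp only [Finset.mem_filter] at hd ⊢
        refine ⟨hd.1, ?_, hd.2.2⟩
        rcases (Nat.lt_succ_iff.1 hd.2.1).lt_or_eq with hlt | rfl
        · exact Or.inl hlt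
        · exact Or.inr ⟨rfl, Nat.find_min' hex hd.2.2⟩
      · rintro ⟨r, j⟩ hd
        simp only [Finset.mem_filter] at hd ⊢
        refine ⟨hd.1, ?_, hd.2.2⟩
        rcases hd.2.1 with hlt | ⟨rfl, hle⟩
        · exact hlt
        · have := h.rows_le (i := r) hle (by omega)
          omega
    · left
      refine Finset.card_le_card ?_
      rintro ⟨r, j⟩ hd
      simp only [Finset.mem_filter] at hd ⊢
      refine ⟨hd.1, ?_, hd.2.2⟩
      rcases (Nat.lt_succ_iff.1 hd.2.1).lt_or_eq with hlt | rfl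
      · exact hlt
      · exact absurd ⟨j, hd.2.2⟩ hex
  induction p with
  | zero =>
    rcases hrow 0 with h1 | h1
    · exact h1.trans (by simp [entriesCard])
    · exact h1
  | succ p ih =>
    rcases hrow (p + 1) with h1 | h1
    · refine h1.trans (ih.trans (Finset.card_le_card fun d hd => ?_))
      simp only [Finset.mem_filter] at hd ⊢
      exact ⟨hd.1, by omega, hd.2.2⟩
    · exact h1

theorem isChain (h : IsLevels nu T C) (hT : IsLRTableau (C 0) mu nu T)
    (hmu : mu.colLen 0 ≤ n) : IsChain n (C 0) nu C := by
  refine ⟨rfl, fun i hi => ?_, fun i => ⟨h.mono (Nat.le_succ i), fun r j hrj => ?_⟩⟩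
  · refine SetLike.ext fun c => ?_
    rw [h.mem_iff, and_iff_left_iff_imp]
    intro hc
    by_contra! hlt
    obtain ⟨k, hk⟩ : ∃ k, T c = k + 1 := ⟨T c - 1, by omega⟩
    have h1 := hT.2.2.2.1 k
    rw [rowLen_eq_zero_of_colLen_le (by omega), Finset.card_eq_zero] at h1
    have : c ∈ (nu.cells \ (C 0).cells).filter (fun c => T c = k + 1) :=
      Finset.mem_filter.2 ⟨h.mem_skew.2 (by omega), hk⟩
    rw [h1] at this
    exact Finset.notMem_empty _ this
  · obtain ⟨h1, h2⟩ := (h.mem_iff _ _).1 hrj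
    refine (h.mem_iff _ _).2 ⟨nu.up_left_mem (Nat.le_succ r) le_rfl h1, ?_⟩
    by_cases h0 : T (r, j) = 0
    · omega
    have h3 : T (r + 1, j) ≠ 0 := by
      intro h4
      have h5 : (r + 1, j) ∈ C 0 := (h.mem_iff _ _).2 ⟨h1, h4.le⟩
      have h6 := ((h.mem_iff _ _).1 ((C 0).up_left_mem (Nat.le_succ r) le_rfl h5)).2
      omega
    have := hT.2.2.1 r (r + 1) j (Nat.lt_succ_self r) (h.mem_skew.2 h0) (h.mem_skew.2 h3)
    omega

theorem unique_filling {T' : ℕ × ℕ → ℕ} (h : IsLevels nu T C) (h' : IsLevels nu T' C) :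
    T = T' := by
  funext c
  by_cases hc : c ∈ nu
  · have h1 := (h'.mem_iff (T c) c).1 ((h.mem_iff (T c) c).2 ⟨hc, le_rfl⟩)
    have h2 := (h.mem_iff (T' c) c).1 ((h'.mem_iff (T' c) c).2 ⟨hc, le_rfl⟩)
    exact le_antisymm h2.2 h1.2
  · rw [h.eq_zero c hc, h'.eq_zero c hc]

theorem unique_levels {C' : ℕ → YoungDiagram} (h : IsLevels nu T C) (h' : IsLevels nu T C') :
    C = C' := by
  funext i
  exact SetLike.ext fun c => by rw [h.mem_iff, h'.mem_iff]

end IsLevels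

theorem IsChain.exists_isLevels {n : ℕ} {lam nu : YoungDiagram} {C : ℕ → YoungDiagram}
    (hC : IsChain n lam nu C) : ∃ T, IsLevels nu T C := by
  have hex : ∀ c, c ∈ nu → ∃ i, c ∈ C i := fun c hc => ⟨n, by rwa [hC.2.1 n le_rfl]⟩
  refine ⟨fun c => if h : c ∈ nu then Nat.find (hex c h) else 0, fun i c => ?_, fun c hc => ?_⟩
  · constructor
    · intro h
      have hc := hC.le i h
      rw [dif_pos hc]
      exact ⟨hc, Nat.find_min' _ h⟩
    · rintro ⟨hc, h⟩
      rw [dif_pos hc] at h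
      exact hC.monotone h (Nat.find_spec (hex c hc))
  · rw [dif_neg hc]

/-- The strictly decreasing sequence attached to a partition. -/
def shiftedParts (mu : YoungDiagram) (k : ℕ) : ℤ := mu.rowLen k - k

theorem shiftedParts_strictAnti (mu : YoungDiagram) : StrictAnti (shiftedParts mu) := by
  refine strictAnti_nat_of_succ_lt fun k => ?_
  have := mu.rowLen_anti k (k + 1) (Nat.le_succ k)
  unfold shiftedParts
  push_cast
  omega

theorem lrCoeff_eq_card (lam nu : YoungDiagram) {mu : YoungDiagram} {n : ℕ}
    (hmu : mu.colLen 0 ≤ n) :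
    lrCoeff lam mu nu = ((chains n lam nu).filter (fun C => IsLattice C ∧
      HasShiftedContent (shiftedParts mu) C (1 : Equiv.Perm (Fin n)))).card := by
  have hcontent : ∀ C : ℕ → YoungDiagram,
      HasShiftedContent (shiftedParts mu) C (1 : Equiv.Perm (Fin n)) ↔
      ∀ k < n, (C (k + 1)).card = (C k).card + mu.rowLen k := by
    intro C
    constructor
    · intro h k hk
      have := h ⟨k, hk⟩
      simp only [Equiv.Perm.one_apply, shiftedParts] at this
      omega
    · rintro h ⟨k, hk⟩
      have := h k hk
      simp only [Equiv.Perm.one_apply, shiftedParts]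
      omega
  rw [lrCoeff]
  split_ifs with hle
  · have hzero : ∀ T, IsLRTableau lam mu nu T → level nu T 0 = lam := by
      intro T hT
      refine SetLike.ext fun c => ?_
      rw [hT.isLevels.mem_iff]
      have h1 := hT.1 c
      simp only [Finset.mem_sdiff, YoungDiagram.mem_cells] at h1
      have h2 : c ∈ lam → c ∈ nu := fun h => hle h
      rw [Nat.le_zero]
      tauto
    rw [← Nat.card_eq_finsetCard]
    refine Nat.card_eq_of_bijective (fun T => ⟨level nu T.1, ?_⟩) ⟨?_, ?_⟩
    · obtain ⟨T, hT⟩ := T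
      have h0 := hzero T hT
      have h := hT.isLevels
      rw [← h0] at hT
      have hC := h.isChain hT hmu
      rw [h0] at hC
      rw [Finset.mem_filter, mem_chains, hcontent]
      refine ⟨hC, h.isLattice hT, fun k _ => ?_⟩
      rw [← h.card_filter_add k, ← hT.2.2.2.1 k, add_comm]
    · rintro ⟨T, hT⟩ ⟨T', hT'⟩ heq
      have h : level nu T = level nu T' := congrArg Subtype.val heq
      exact Subtype.ext (hT.isLevels.unique_filling (h ▸ hT'.isLevels))
    · rintro ⟨C, hC⟩
      rw [Finset.mem_filter, mem_chains, hcontent] at hC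
      obtain ⟨T, hT⟩ := hC.1.exists_isLevels
      have h0 := hC.1.1
      have h1 := hC.1
      rw [← h0] at h1
      have h2 := hT.isLRTableau h1 hC.2.1 hmu hC.2.2
      rw [h0] at h2
      exact ⟨⟨T, h2⟩, Subtype.ext (h2.isLevels.unique_levels hT)⟩
  · symm
    rw [Finset.card_eq_zero, Finset.eq_empty_iff_forall_notMem]
    intro C hC
    rw [Finset.mem_filter, mem_chains] at hC
    exact hle (hC.1.1.ge.trans (hC.1.le 0))

theorem IsLRTableau.rowLen_ne_zero {lam mu nu : YoungDiagram} {T : ℕ × ℕ → ℕ}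
    (h : IsLRTableau lam mu nu T) {c : ℕ × ℕ} (hc : c ∈ nu.cells \ lam.cells) {k : ℕ}
    (hk : T c = k + 1) : mu.rowLen k ≠ 0 := by
  rw [← h.2.2.2.1 k]
  exact Finset.card_ne_zero_of_mem (Finset.mem_filter.2 ⟨hc, hk⟩)

section straight

variable {mu nu : YoungDiagram} {T : ℕ × ℕ → ℕ}

theorem IsLRTableau.eq_of_bot (h : IsLRTableau ⊥ mu nu T) {c : ℕ × ℕ} (hc : c ∈ nu) :
    T c = c.1 + 1 := by
  have hs : ∀ d : ℕ × ℕ, d ∈ nu.cells \ (⊥ : YoungDiagram).cells ↔ d ∈ nu := fun d => by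
    simp [YoungDiagram.cells_bot]
  have h0 : level nu T 0 = ⊥ := by
    refine SetLike.ext fun d => ?_
    rw [h.isLevels.mem_iff]
    have h1 := h.1 d
    rw [hs] at h1
    simp only [YoungDiagram.notMem_bot, iff_false]
    rintro ⟨h2, h3⟩
    exact h1.1 h2 (Nat.le_zero.1 h3)
  have hlat : IsLattice (level nu T) := h.isLevels.isLattice (h0.symm ▸ h)
  apply le_antisymm
  · by_contra! hlt
    have key : ∀ k, entriesCard ⊥ nu T k k = 0 := by
      intro k
      induction k with
      | zero => simp [entriesCard]
      | succ k ih =>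
        have := hlat k k
        rw [h.isLevels.violatesAt_iff, h0] at this
        omega
    obtain ⟨k, hk⟩ : ∃ k, T c = k + 1 := ⟨T c - 1, by omega⟩
    have := key k
    rw [entriesCard, Finset.card_eq_zero, Finset.eq_empty_iff_forall_notMem] at this
    exact this c (Finset.mem_filter.2 ⟨(hs c).2 hc, by omega, hk⟩)
  · obtain ⟨r, j⟩ := c
    induction r with
    | zero => exact Nat.one_le_iff_ne_zero.2 ((h.1 _).1 ((hs _).2 hc))
    | succ r ih =>
      have hc' := nu.up_left_mem (Nat.le_succ r) le_rfl hc
      have h1 := ih hc'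
      have h2 := h.2.2.1 r (r + 1) j (Nat.lt_succ_self r) ((hs _).2 hc') ((hs _).2 hc)
      simp only at h1 ⊢
      omega

theorem isLRTableau_bot (nu : YoungDiagram) :
    IsLRTableau ⊥ nu nu (fun c => if c ∈ nu then c.1 + 1 else 0) := by
  have hs : ∀ d : ℕ × ℕ, d ∈ nu.cells \ (⊥ : YoungDiagram).cells ↔ d ∈ nu := fun d => by
    simp [YoungDiagram.cells_bot]
  refine ⟨fun c => ?_, ?_, ?_, ?_, ?_⟩
  · rw [hs]
    by_cases h : c ∈ nu <;> simp [h]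
  · intro i j j' _ h h'
    rw [hs] at h h'
    simp [h, h']
  · intro i i' j hi h h'
    rw [hs] at h h'
    simp [h, h', hi]
  · intro k
    rw [YoungDiagram.rowLen_eq_card]
    congr 1
    ext ⟨r, j⟩
    simp only [Finset.mem_filter, hs, YoungDiagram.mem_row_iff]
    constructor
    · rintro ⟨h1, h2⟩
      rw [if_pos h1] at h2
      exact ⟨h1, by simpa using h2⟩
    · rintro ⟨h1, h2⟩
      rw [if_pos h1]
      exact ⟨h1, by simpa using h2⟩
  · intro c _ k
    refine Finset.card_le_card_of_injOn (fun d => (d.1 - 1, d.2)) ?_ ?_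
    · rintro ⟨r, j⟩ hd
      simp only [Finset.coe_filter, Set.mem_ofPred_eq, hs] at hd ⊢
      rw [if_pos hd.1] at hd
      have h1 := nu.up_left_mem (Nat.sub_le r 1) le_rfl hd.1
      rw [if_pos h1]
      exact ⟨h1, Or.inl (by omega), by omega⟩
    · rintro ⟨r, j⟩ hd ⟨r', j'⟩ hd' heq
      simp only [Finset.coe_filter, Set.mem_ofPred_eq, hs] at hd hd'
      rw [if_pos hd.1] at hd
      rw [if_pos hd'.1] at hd'
      simp only [Prod.mk.injEq] at heq ⊢
      exact ⟨by omega, heq.2⟩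

theorem lrCoeff_bot (mu nu : YoungDiagram) : lrCoeff ⊥ mu nu = if mu = nu then 1 else 0 := by
  rw [lrCoeff, if_pos bot_le]
  have huniq : ∀ T, IsLRTableau ⊥ mu nu T → T = fun c => if c ∈ nu then c.1 + 1 else 0 := by
    intro T h
    funext c
    split_ifs with hc
    · exact h.eq_of_bot hc
    · exact h.isLevels.eq_zero c hc
  split_ifs with heq
  · subst heq
    rw [Nat.card_eq_one_iff_unique]
    exact ⟨⟨fun T T' => Subtype.ext ((huniq _ T.2).trans (huniq _ T'.2).symm)⟩,
      ⟨⟨_, isLRTableau_bot mu⟩⟩⟩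
  · rw [Nat.card_eq_zero]
    refine Or.inl ⟨fun ⟨T, h⟩ => heq (ext_rowLen fun k => ?_)⟩
    have h1 := isLRTableau_bot nu
    rw [← huniq T h] at h1
    rw [← h.2.2.2.1 k, h1.2.2.2.1 k]

end straight

/-- `b / a` is a vertical strip. -/
def IsVStrip (a b : YoungDiagram) : Prop :=
  a ≤ b ∧ ∀ i j, (i, j + 1) ∈ b → (i, j) ∈ a

theorem isHStrip_transpose {a b : YoungDiagram} :
    IsHStrip a.transpose b.transpose ↔ IsVStrip a b := by
  unfold IsHStrip IsVStrip
  rw [YoungDiagram.transpose_le_iff]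
  simp only [YoungDiagram.mem_transpose, Prod.swap_prod_mk]
  exact and_congr_right fun _ => ⟨fun h i j => h j i, fun h i j => h j i⟩

theorem rowLen_column (k i : ℕ) : (rect k 1).rowLen i = if i < k then 1 else 0 := by
  have h : ∀ j, j < (rect k 1).rowLen i ↔ i < k ∧ j < 1 := by
    intro j
    rw [← YoungDiagram.mem_iff_lt_rowLen, ← YoungDiagram.mem_cells]
    simp only [rect, Finset.mem_product, Finset.mem_range]
  have h0 := h 0
  have h1 := h 1
  split_ifs <;> omega

section column

variable {lam nu : YoungDiagram} {k : ℕ} {T : ℕ × ℕ → ℕ}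

theorem IsVStrip.eq_of_fst_eq (h : IsVStrip lam nu) {c d : ℕ × ℕ}
    (hc : c ∈ nu.cells \ lam.cells) (hd : d ∈ nu.cells \ lam.cells) (heq : c.1 = d.1) :
    c = d := by
  obtain ⟨i, j⟩ := c
  obtain ⟨i', j'⟩ := d
  obtain rfl : i = i' := heq
  simp only [Finset.mem_sdiff, YoungDiagram.mem_cells] at hc hd
  rcases lt_trichotomy j j' with hlt | rfl | hlt
  · exact absurd (h.2 i j (nu.up_left_mem le_rfl hlt hd.1)) hc.2
  · rfl
  · exact absurd (h.2 i j' (nu.up_left_mem le_rfl hlt hc.1)) hd.2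


namespace IsLRTableau

variable (h : IsLRTableau lam (rect k 1) nu T)
include h

theorem column_injOn : Set.InjOn T (nu.cells \ lam.cells : Finset (ℕ × ℕ)) := by
  intro c hc d hd heq
  rw [Finset.mem_coe] at hc hd
  obtain ⟨t, ht⟩ := Nat.exists_eq_succ_of_ne_zero ((h.1 c).1 hc)
  have h1 := h.2.2.2.1 t
  rw [rowLen_column] at h1
  have h2 := Finset.card_le_one.1 (h1.le.trans (by split_ifs <;> omega))
  exact h2 c (Finset.mem_filter.2 ⟨hc, ht⟩) d (Finset.mem_filter.2 ⟨hd, heq.symm.trans ht⟩)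

theorem exists_earlier_entry {c : ℕ × ℕ} (hc : c ∈ nu.cells \ lam.cells) {m : ℕ} (hm : m < T c) :
    ∃ d ∈ nu.cells \ lam.cells, (d.1 < c.1 ∨ (d.1 = c.1 ∧ c.2 ≤ d.2)) ∧ T d = m + 1 := by
  obtain ⟨e, he⟩ : ∃ e, T c = m + 1 + e := ⟨T c - (m + 1), by omega⟩
  clear hm
  induction e generalizing m with
  | zero => exact ⟨c, hc, Or.inr ⟨rfl, le_rfl⟩, he⟩
  | succ e ih =>
    obtain ⟨d, hd, h1, h2⟩ := ih (m := m + 1) (by omega)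
    have h3 := h.2.2.2.2 c hc m
    have h4 := (Finset.card_pos.2 ⟨d, Finset.mem_filter.2 ⟨hd, h1, h2⟩⟩).trans_le h3
    obtain ⟨d', hd'⟩ := Finset.card_pos.1 h4
    rw [Finset.mem_filter] at hd'
    exact ⟨d', hd'⟩

theorem column_lt {c d : ℕ × ℕ} (hc : c ∈ nu.cells \ lam.cells)
    (hd : d ∈ nu.cells \ lam.cells) (hlt : d.1 < c.1) : T d < T c := by
  by_contra! hle
  have hpos := Nat.pos_of_ne_zero ((h.1 c).1 hc)
  obtain ⟨e, he, h1, h2⟩ := h.exists_earlier_entry hd (m := T c - 1) (by omega)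
  have := h.column_injOn he hc (by omega)
  subst this
  omega

theorem column_isVStrip (hle : lam ≤ nu) : IsVStrip lam nu := by
  refine ⟨hle, fun i j hij => by_contra fun hij' => ?_⟩
  have hd : (i, j) ∈ nu.cells \ lam.cells := by
    simp only [Finset.mem_sdiff, YoungDiagram.mem_cells]
    exact ⟨nu.up_left_mem le_rfl (Nat.le_succ j) hij, hij'⟩
  have hc : (i, j + 1) ∈ nu.cells \ lam.cells := by
    simp only [Finset.mem_sdiff, YoungDiagram.mem_cells]
    exact ⟨hij, fun h' => hij' (lam.up_left_mem le_rfl (Nat.le_succ j) h')⟩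
  have h1 := h.2.1 i j (j + 1) (Nat.le_succ j) hd hc
  have hpos := Nat.pos_of_ne_zero ((h.1 _).1 hd)
  obtain ⟨e, he, h2, h3⟩ := h.exists_earlier_entry hc (m := T (i, j) - 1) (by omega)
  have := h.column_injOn he hd (by omega)
  subst this
  simp only at h2
  omega

theorem column_le {c : ℕ × ℕ} (hc : c ∈ nu.cells \ lam.cells) : T c ≤ k := by
  by_contra! hlt
  refine h.rowLen_ne_zero hc (k := T c - 1) (by omega) ?_
  rw [rowLen_column, if_neg (by omega)]

theorem card_le_entry {m : ℕ} (hm : m ≤ k) :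
    ((nu.cells \ lam.cells).filter fun d => T d ≤ m).card = m := by
  rw [Finset.card_eq_sum_card_fiberwise (f := fun d => T d - 1) (t := Finset.range m)]
  · rw [Finset.sum_congr rfl (g := fun _ => 1), Finset.sum_const, Finset.card_range, smul_eq_mul,
      mul_one]
    intro t ht
    rw [Finset.mem_range] at ht
    have h1 := h.2.2.2.1 t
    rw [rowLen_column, if_pos (by omega)] at h1
    rw [← h1, Finset.filter_filter]
    congr 1
    refine Finset.filter_congr fun c hc => ?_
    have := (h.1 c).1 hc
    omega
  · intro c hc
    simp only [Finset.coe_filter, Set.mem_ofPred_eq] at hc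
    have := (h.1 c).1 hc.1
    simp only [Finset.coe_range, Set.mem_Iio]
    omega

theorem column_card : (nu.cells \ lam.cells).card = k := by
  rw [← h.card_le_entry le_rfl, Finset.filter_true_of_mem fun c hc => h.column_le hc]

theorem column_eq (hle : lam ≤ nu) {c : ℕ × ℕ} (hc : c ∈ nu.cells \ lam.cells) :
    T c = ((nu.cells \ lam.cells).filter fun d => d.1 ≤ c.1).card := by
  rw [← h.card_le_entry (h.column_le hc)]
  congr 1
  refine Finset.filter_congr fun d hd => ⟨fun h1 => ?_, fun h1 => ?_⟩
  · by_contra! hlt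
    exact absurd (h.column_lt hd hc hlt) (by omega)
  · rcases h1.lt_or_eq with hlt | heq
    · exact (h.column_lt hc hd hlt).le
    · rw [(h.column_isVStrip hle).eq_of_fst_eq hd hc heq]

end IsLRTableau

/-- The filling of `ν / λ` by the number of cells weakly above. -/
def columnFilling (lam nu : YoungDiagram) (c : ℕ × ℕ) : ℕ :=
  if c ∈ nu.cells \ lam.cells then ((nu.cells \ lam.cells).filter fun d => d.1 ≤ c.1).card else 0

theorem columnFilling_of_mem {c : ℕ × ℕ} (hc : c ∈ nu.cells \ lam.cells) :
    columnFilling lam nu c = ((nu.cells \ lam.cells).filter fun d => d.1 ≤ c.1).card :=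
  if_pos hc

theorem columnFilling_ne_zero {c : ℕ × ℕ} :
    c ∈ nu.cells \ lam.cells ↔ columnFilling lam nu c ≠ 0 := by
  unfold columnFilling
  split_ifs with h
  · exact iff_of_true h (Finset.card_ne_zero_of_mem (Finset.mem_filter.2 ⟨h, le_rfl⟩))
  · exact iff_of_false h fun h' => h' rfl

theorem columnFilling_lt {c d : ℕ × ℕ} (hc : c ∈ nu.cells \ lam.cells)
    (hd : d ∈ nu.cells \ lam.cells) (hlt : d.1 < c.1) :
    columnFilling lam nu d < columnFilling lam nu c := by
  rw [columnFilling_of_mem hc, columnFilling_of_mem hd]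
  refine Finset.card_lt_card (Finset.ssubset_iff.2 ⟨c, ?_, fun e he => ?_⟩)
  · simp only [Finset.mem_filter]
    omega
  · rw [Finset.mem_insert, Finset.mem_filter] at he
    rw [Finset.mem_filter]
    rcases he with rfl | he
    · exact ⟨hc, le_rfl⟩
    · exact ⟨he.1, by omega⟩

theorem columnFilling_injOn (h : IsVStrip lam nu) :
    Set.InjOn (columnFilling lam nu) (nu.cells \ lam.cells : Finset (ℕ × ℕ)) := by
  intro c hc d hd heq
  rw [Finset.mem_coe] at hc hd
  rcases lt_trichotomy c.1 d.1 with hlt | h1 | hlt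
  · exact absurd heq (columnFilling_lt hd hc hlt).ne
  · exact h.eq_of_fst_eq hc hd h1
  · exact absurd heq (columnFilling_lt hc hd hlt).ne'

theorem image_columnFilling (h : IsVStrip lam nu) :
    (nu.cells \ lam.cells).image (columnFilling lam nu) =
      Finset.Icc 1 (nu.cells \ lam.cells).card := by
  refine Finset.eq_of_subset_of_card_le (fun t ht => ?_) ?_
  · obtain ⟨c, hc, rfl⟩ := Finset.mem_image.1 ht
    rw [Finset.mem_Icc]
    refine ⟨Nat.one_le_iff_ne_zero.2 (columnFilling_ne_zero.1 hc), ?_⟩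
    rw [columnFilling_of_mem hc]
    exact Finset.card_filter_le _ _
  · rw [Finset.card_image_of_injOn (columnFilling_injOn h), Nat.card_Icc, Nat.add_sub_cancel]

theorem isLRTableau_columnFilling (h : IsVStrip lam nu) :
    IsLRTableau lam (rect (nu.cells \ lam.cells).card 1) nu (columnFilling lam nu) := by
  have himage : ∀ t, (∃ c ∈ nu.cells \ lam.cells, columnFilling lam nu c = t + 1) ↔
      t < (nu.cells \ lam.cells).card := by
    intro t
    rw [← Finset.mem_image, image_columnFilling h, Finset.mem_Icc]
    omega
  refine ⟨fun c => columnFilling_ne_zero, ?_, ?_, ?_, ?_⟩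
  · intro i j j' _ hc hc'
    rw [h.eq_of_fst_eq hc hc' rfl]
  · intro i i' j hi hc hc'
    exact columnFilling_lt hc' hc hi
  · intro t
    rw [rowLen_column]
    split_ifs with ht
    · obtain ⟨c, hc, h1⟩ := (himage t).2 ht
      refine Finset.card_eq_one.2 ⟨c, Finset.ext fun d => ?_⟩
      rw [Finset.mem_filter, Finset.mem_singleton]
      constructor
      · rintro ⟨hd, h2⟩
        exact columnFilling_injOn h hd hc (h2.trans h1.symm)
      · rintro rfl
        exact ⟨hc, h1⟩
    · rw [Finset.card_eq_zero, Finset.eq_empty_iff_forall_notMem]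
      intro c hc
      rw [Finset.mem_filter] at hc
      exact ht ((himage t).1 ⟨c, hc⟩)
  · intro c _ t
    rcases Finset.eq_empty_or_nonempty ((nu.cells \ lam.cells).filter
      (fun d => (d.1 < c.1 ∨ (d.1 = c.1 ∧ c.2 ≤ d.2)) ∧ columnFilling lam nu d = t + 2))
      with h0 | ⟨d, hd⟩
    · rw [h0]
      exact Nat.zero_le _
    · rw [Finset.mem_filter] at hd
      refine (Finset.card_le_one.2 fun e he e' he' => ?_).trans (Finset.card_pos.2 ?_)
      · rw [Finset.mem_filter] at he he'
        exact columnFilling_injOn h he.1 he'.1 (he.2.2.trans he'.2.2.symm)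
      · obtain ⟨e, he, h1⟩ := (himage t).2 ((Nat.lt_succ_self t).trans
          ((himage (t + 1)).1 ⟨d, hd.1, hd.2.2⟩))
        refine ⟨e, Finset.mem_filter.2 ⟨he, Or.inl ?_, h1⟩⟩
        have h2 : e.1 < d.1 := by
          by_contra! hle
          rcases hle.lt_or_eq with hlt | heq
          · have := columnFilling_lt he hd.1 hlt
            omega
          · have := h.eq_of_fst_eq he hd.1 heq.symm
            subst this
            omega
        omega

theorem lrCoeff_column (lam nu : YoungDiagram) (k : ℕ) :
    lrCoeff lam (rect k 1) nu = if IsVStrip lam nu ∧ nu.card = lam.card + k then 1 else 0 := by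
  rw [lrCoeff]
  by_cases hle : lam ≤ nu
  · have hcard : (nu.cells \ lam.cells).card + lam.card = nu.card :=
      Finset.card_sdiff_add_card_eq_card (YoungDiagram.cells_subset_iff.2 hle)
    rw [if_pos hle]
    split_ifs with h
    · obtain rfl : k = (nu.cells \ lam.cells).card := by omega
      rw [Nat.card_eq_one_iff_unique]
      have huniq : ∀ T, IsLRTableau lam (rect (nu.cells \ lam.cells).card 1) nu T →
          T = columnFilling lam nu := by
        intro T hT
        funext c
        by_cases hc : c ∈ nu.cells \ lam.cells
        · rw [hT.column_eq hle hc, columnFilling_of_mem hc]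
        · rw [columnFilling, if_neg hc]
          exact not_not.1 (mt (hT.1 c).2 hc)
      exact ⟨⟨fun T T' => Subtype.ext ((huniq _ T.2).trans (huniq _ T'.2).symm)⟩,
        ⟨⟨_, isLRTableau_columnFilling h.1⟩⟩⟩
    · rw [Nat.card_eq_zero]
      refine Or.inl ⟨fun ⟨T, hT⟩ => h ⟨hT.column_isVStrip hle, ?_⟩⟩
      have := hT.column_card
      omega
  · rw [if_neg hle, if_neg fun h => hle h.1.1]

end column

/-- The operator of Littlewood–Richardson coefficients of content `μ`. -/
def lrOp (mu : YoungDiagram) : YoungAlgebra :=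
  ⟨fun a b => lrCoeff a mu b, fun a b h => by rw [lrCoeff, if_neg h, Nat.cast_zero]⟩

theorem lrOp_apply (mu a b : YoungDiagram) : lrOp mu a b = lrCoeff a mu b := rfl

theorem lrOp_mem (mu : YoungDiagram) : lrOp mu ∈ stripRing := by
  obtain ⟨x, hx, h⟩ := exists_mem_stripRing (mu.colLen 0) (shiftedParts_strictAnti mu)
  convert hx
  ext a b _
  rw [h, lrOp_apply, lrCoeff_eq_card a b le_rfl]

theorem lrOp_bot (mu nu : YoungDiagram) : lrOp mu ⊥ nu = if mu = nu then 1 else 0 := by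
  rw [lrOp_apply, lrCoeff_bot]
  split_ifs <;> rfl

theorem lrOp_mul_bot (lam nu : YoungDiagram) (x : YoungAlgebra) :
    (lrOp lam * x) ⊥ nu = x lam nu := by
  rw [IncidenceAlgebra.mul_apply]
  simp only [lrOp_bot, ite_mul, one_mul, zero_mul, Finset.sum_ite_eq, Finset.mem_Icc, bot_le,
    true_and]
  split_ifs with h
  · rfl
  · exact (IncidenceAlgebra.apply_eq_zero_of_not_le h x).symm

/-- An element of `stripRing` is determined by its row indexed by the empty diagram. -/
theorem eq_of_bot_row {x y : YoungAlgebra} (hx : x ∈ stripRing) (hy : y ∈ stripRing)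
    (h : ∀ nu, x ⊥ nu = y ⊥ nu) : x = y := by
  ext a b _
  rw [← lrOp_mul_bot, ← lrOp_mul_bot a, stripRing_comm (lrOp_mem a) hx,
    stripRing_comm (lrOp_mem a) hy, IncidenceAlgebra.mul_apply, IncidenceAlgebra.mul_apply]
  simp only [h]

/-- The automorphism of the incidence algebra induced by transposition of diagrams. -/
def transposeHom : YoungAlgebra →+* YoungAlgebra where
  toFun x := ⟨fun a b => x a.transpose b.transpose, fun _ _ h =>
    IncidenceAlgebra.apply_eq_zero_of_not_le (mt YoungDiagram.transpose_le_iff.1 h) x⟩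
  map_one' := by
    ext a b _
    simp [YoungDiagram.transpose_eq_iff]
  map_mul' x y := by
    ext a b _
    simp only [IncidenceAlgebra.coe_mk, IncidenceAlgebra.mul_apply]
    refine Finset.sum_nbij' YoungDiagram.transpose YoungDiagram.transpose ?_ ?_ ?_ ?_ ?_
    · intro c hc
      rw [Finset.mem_Icc] at hc ⊢
      rwa [← YoungDiagram.transpose_le_iff (μ := a), ← YoungDiagram.transpose_le_iff (ν := b),
        YoungDiagram.transpose_transpose]
    · intro c hc
      rw [Finset.mem_Icc] at hc ⊢
      rwa [YoungDiagram.transpose_le_iff, YoungDiagram.transpose_le_iff]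
    · exact fun c _ => c.transpose_transpose
    · exact fun c _ => c.transpose_transpose
    · intro c _
      rw [YoungDiagram.transpose_transpose]
  map_zero' := rfl
  map_add' _ _ := rfl

theorem transposeHom_apply (x : YoungAlgebra) (a b : YoungDiagram) :
    transposeHom x a b = x a.transpose b.transpose := rfl

theorem card_transpose_s9 (a : YoungDiagram) : a.transpose.card = a.card := by
  refine Finset.card_nbij' Prod.swap Prod.swap ?_ ?_ ?_ ?_ <;> intro c hc <;>
    simp_all [YoungDiagram.mem_transpose]

theorem transposeHom_stripOp (k : ℤ) : transposeHom (stripOp k) ∈ stripRing := by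
  have happ : ∀ a b, transposeHom (stripOp k) a b =
      if IsVStrip a b ∧ (b.card : ℤ) = a.card + k then 1 else 0 := fun a b => by
    rw [transposeHom_apply, stripOp_apply, isHStrip_transpose, card_transpose_s9, card_transpose_s9]
  rcases le_or_gt 0 k with hk | hk
  · lift k to ℕ using hk
    convert lrOp_mem (rect k 1)
    ext a b _
    rw [happ, lrOp_apply, lrCoeff_column]
    norm_cast
  · convert zero_mem stripRing
    ext a b _
    rw [happ, IncidenceAlgebra.zero_apply, if_neg]
    rintro ⟨h, h'⟩
    have := card_mono h.1
    omega

theorem transposeHom_mem {x : YoungAlgebra} (hx : x ∈ stripRing) :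
    transposeHom x ∈ stripRing := by
  have hle : stripRing ≤ stripRing.comap transposeHom := by
    rw [stripRing, Subring.closure_le]
    rintro _ ⟨k, rfl⟩
    exact transposeHom_stripOp k
  exact hle hx

theorem transposeHom_lrOp (mu : YoungDiagram) : transposeHom (lrOp mu) = lrOp mu.transpose := by
  refine eq_of_bot_row (transposeHom_mem (lrOp_mem mu)) (lrOp_mem _) fun nu => ?_
  have hbot : (⊥ : YoungDiagram).transpose = ⊥ :=
    SetLike.ext fun c => by simp [YoungDiagram.mem_transpose]
  rw [transposeHom_apply, hbot, lrOp_bot, lrOp_bot, YoungDiagram.transpose_eq_iff_eq_transpose]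

theorem lrCoeff_comm (lam mu nu : YoungDiagram) : lrCoeff lam mu nu = lrCoeff mu lam nu := by
  have h := congrArg (fun x : YoungAlgebra => x ⊥ nu)
    (stripRing_comm (lrOp_mem lam) (lrOp_mem mu))
  simp only [lrOp_mul_bot, lrOp_apply] at h
  exact_mod_cast h

theorem lrCoeff_transpose (lam mu nu : YoungDiagram) :
    lrCoeff lam.transpose mu.transpose nu.transpose = lrCoeff lam mu nu := by
  have h : transposeHom (lrOp mu.transpose) lam nu = lrOp mu lam nu := by
    rw [transposeHom_lrOp, YoungDiagram.transpose_transpose]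
  rw [transposeHom_apply, lrOp_apply, lrOp_apply] at h
  exact_mod_cast h

theorem hookProd_transpose (nu : YoungDiagram) : hookProd nu.transpose = hookProd nu := by
  unfold hookProd
  refine Finset.prod_nbij' Prod.swap Prod.swap ?_ ?_ ?_ ?_ ?_
  · intro c hc
    simpa [YoungDiagram.mem_transpose] using hc
  · intro c hc
    simpa [YoungDiagram.mem_transpose] using hc
  · exact fun c _ => c.swap_swap
  · exact fun c _ => c.swap_swap
  · intro c _
    rw [YoungDiagram.rowLen_transpose, YoungDiagram.colLen_transpose, Prod.fst_swap, Prod.snd_swap]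
    congr 1
    omega

/-- Symmetry: `P_{λ,μ}(e,f) = P_{μ,λ}(f,e)`. -/
theorem P_symm (lam mu : YoungDiagram) (e f : ℚ) :
    P lam mu e f = P mu lam f e := by
  unfold P
  rw [← finsum_comp_equiv YoungDiagram.transposeOrderIso.toEquiv]
  refine finsum_congr fun nu => ?_
  change (lrCoeff lam.transpose mu nu.transpose.transpose : ℚ) * skewContPoly e nu.transpose lam *
    skewContPoly f nu.transpose.transpose mu / hookProd nu.transpose = _
  rw [hookProd_transpose, YoungDiagram.transpose_transpose, lrCoeff_comm mu.transpose lam,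
    ← lrCoeff_transpose lam mu.transpose nu.transpose, YoungDiagram.transpose_transpose,
    YoungDiagram.transpose_transpose, mul_right_comm]

end ChernTensor
end
end
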